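/- Fix σ > 0 and c > 0. For μ > 0 define N_D¹(μ) := #{(n,k) ∈ ℤ×ℤ : k ≥ 1, |n| < c·k, and (n, k + max(0,−n) − 3/4) ∈ μD} and N¹_σ(μ) := #{(n,k) ∈ ℤ×ℤ : k ≥ 1, |n| < c·k, and #{t ∈ (0,μ] : φ_{|n|,σ}(t) = 0} ≥ k}. Then there exist C > 0 and μ₀ > 0 such that for all μ ≥ μ₀: N_D¹(μ − C/μ) ≤ N¹_σ(μ) ≤ N_D¹(μ + C/μ). -/

import Mathlib

open Real MeasureTheory Pointwise

/-- The Bessel function of integer order `n`: `J_n(x) = (1/π)∫₀^π cos(x sin t − n t) dt`. -/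
noncomputable def besselJ (n : ℕ) (x : ℝ) : ℝ :=
  (1 / π) * ∫ t in (0:ℝ)..π, Real.cos (x * Real.sin t - n * t)

/-- The derivative `J_n′` of the Bessel function. -/
noncomputable def besselJ' (n : ℕ) (x : ℝ) : ℝ := deriv (besselJ n) x

/-- `φ_{n,σ}(x) = x·J_n′(x) + σ·J_n(x)`. -/
noncomputable def phiRobin (σ : ℝ) (n : ℕ) (x : ℝ) : ℝ :=
  x * besselJ' n x + σ * besselJ n x

/-- `g(x) = (1/π)(√(1−x²) − x·arccos x)`. -/
noncomputable def gfun (x : ℝ) : ℝ :=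
  (1 / π) * (Real.sqrt (1 - x ^ 2) - x * Real.arccos x)

/-- The cusped domain `D = {(x,y) : −1 ≤ x ≤ 1, max(0,−x) ≤ y ≤ g(x)}`. -/
def domD : Set (ℝ × ℝ) :=
  {p | -1 ≤ p.1 ∧ p.1 ≤ 1 ∧ max 0 (-p.1) ≤ p.2 ∧ p.2 ≤ gfun p.1}

/-- `N_D¹(μ) = #{(n,k) ∈ ℤ×ℤ : k ≥ 1, |n| < c·k, (n, k + max(0,−n) − 3/4) ∈ μD}`. -/
noncomputable def latticeCountD1 (c μ : ℝ) : ℕ :=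
  ({p : ℤ × ℤ | 1 ≤ p.2 ∧ |(p.1 : ℝ)| < c * (p.2 : ℝ) ∧
    ((p.1 : ℝ), (p.2 : ℝ) + max 0 (-(p.1 : ℝ)) - 3/4) ∈ μ • domD}).ncard

/-- `N¹_σ(μ) = #{(n,k) ∈ ℤ×ℤ : k ≥ 1, |n| < c·k, #{t ∈ (0,μ] : φ_{|n|,σ}(t) = 0} ≥ k}`. -/
noncomputable def diskRobinCount1 (σ c μ : ℝ) : ℕ :=
  ({p : ℤ × ℤ | 1 ≤ p.2 ∧ |(p.1 : ℝ)| < c * (p.2 : ℝ) ∧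
    p.2 ≤ (({t : ℝ | t ∈ Set.Ioc 0 μ ∧ phiRobin σ p.1.natAbs t = 0}).ncard : ℤ)}).ncard




lemma bj_intble (f : ℝ → ℝ) (hf : Continuous f) (a b : ℝ) : IntervalIntegrable f volume a b :=
  hf.intervalIntegrable a b

lemma bj_hasDeriv_int (n : ℕ) (x : ℝ) :
    HasDerivAt (besselJ n) ((1 / π) * ∫ t in (0:ℝ)..π, -(Real.sin (x * Real.sin t - n * t) * Real.sin t)) x := by
  unfold besselJ
  apply HasDerivAt.const_mul
  have := intervalIntegral.hasDerivAt_integral_of_dominated_loc_of_deriv_le (𝕜 := ℝ) (μ := volume)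
    (F := fun x t => Real.cos (x * Real.sin t - n * t))
    (F' := fun x t => -(Real.sin (x * Real.sin t - n * t) * Real.sin t))
    (x₀ := x) (s := Set.univ) (a := 0) (b := π) (bound := fun _ => 1) Filter.univ_mem
    (Filter.Eventually.of_forall fun y => (by fun_prop : Continuous _).aestronglyMeasurable)
    (by apply Continuous.intervalIntegrable; fun_prop)
    ((by fun_prop : Continuous _).aestronglyMeasurable)
    (by
      refine Filter.Eventually.of_forall fun t _ y _ => ?_
      rw [norm_neg, norm_mul]
      have h1 := Real.abs_sin_le_one (y * Real.sin t - n * t)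
      have h2 := Real.abs_sin_le_one t
      simp only [Real.norm_eq_abs]
      nlinarith [abs_nonneg (Real.sin t), abs_nonneg (Real.sin (y * Real.sin t - n * t))])
    (by simp)
    (by
      refine Filter.Eventually.of_forall fun t _ y _ => ?_
      have h : HasDerivAt (fun y : ℝ => y * Real.sin t - n * t) (Real.sin t) y := by
        simpa using ((hasDerivAt_id y).mul_const (Real.sin t)).sub_const (n * t)
      refine h.cos.congr_deriv ?_
      ring)
  exact this.2

/-- boundary term identity -/
lemma bj_boundary (n : ℕ) (x : ℝ) :
    x * ∫ t in (0:ℝ)..π, Real.cos (x * Real.sin t - n * t) * Real.cos t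
      = n * ∫ t in (0:ℝ)..π, Real.cos (x * Real.sin t - n * t) := by
  have h := intervalIntegral.integral_eq_sub_of_hasDerivAt (a := 0) (b := π)
    (f := fun t => Real.sin (x * Real.sin t - n * t))
    (f' := fun t => Real.cos (x * Real.sin t - n * t) * (x * Real.cos t - n))
    (by
      intro t _
      have h : HasDerivAt (fun t : ℝ => x * Real.sin t - n * t) (x * Real.cos t - n) t := by
        refine (((Real.hasDerivAt_sin t).const_mul x).sub ((hasDerivAt_id t).const_mul (n:ℝ))).congr_deriv ?_
        simp
      exact h.sin)
    (by apply Continuous.intervalIntegrable; fun_prop)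
  have h0 : Real.sin (x * Real.sin π - n * π) - Real.sin (x * Real.sin 0 - n * 0) = 0 := by
    have : x * Real.sin π - n * π = -(n * π) := by simp
    rw [this, Real.sin_neg, Real.sin_nat_mul_pi]; simp
  rw [h0] at h
  rw [← intervalIntegral.integral_const_mul, ← intervalIntegral.integral_const_mul, ← sub_eq_zero,
    ← intervalIntegral.integral_sub, ← h]
  · congr 1; ext t; ring
  · apply Continuous.intervalIntegrable; fun_prop
  · apply Continuous.intervalIntegrable; fun_prop

lemma bj_rec1 (n : ℕ) (x : ℝ) : x * deriv (besselJ n) x = n * besselJ n x - x * besselJ (n+1) x := by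
  rw [(bj_hasDeriv_int n x).deriv]
  have hb := bj_boundary n x
  have : besselJ (n+1) x = (1/π) * ((∫ t in (0:ℝ)..π, Real.cos (x * Real.sin t - n * t) * Real.cos t) - 
      ∫ t in (0:ℝ)..π, -(Real.sin (x * Real.sin t - n * t) * Real.sin t)) := by
    unfold besselJ
    rw [← intervalIntegral.integral_sub]
    · congr 2; ext t
      have : x * Real.sin t - ((n+1:ℕ):ℝ) * t = (x * Real.sin t - n * t) - t := by push_cast; ring
      rw [this, Real.cos_sub]; ring
    · apply Continuous.intervalIntegrable; fun_prop
    · apply Continuous.intervalIntegrable; fun_prop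
  rw [this]; unfold besselJ
  linear_combination (1/π) * (-1) * hb * (-1)

lemma bj_rec2 (n : ℕ) (x : ℝ) :
    x * deriv (besselJ (n+1)) x = x * besselJ n x - (n+1) * besselJ (n+1) x := by
  rw [(bj_hasDeriv_int (n+1) x).deriv]
  have hb := bj_boundary (n+1) x
  have : besselJ n x = (1/π) * ((∫ t in (0:ℝ)..π, Real.cos (x * Real.sin t - (n+1:ℕ) * t) * Real.cos t) +
      ∫ t in (0:ℝ)..π, -(Real.sin (x * Real.sin t - (n+1:ℕ) * t) * Real.sin t)) := by
    unfold besselJ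
    rw [← intervalIntegral.integral_add]
    · congr 2; ext t
      have : x * Real.sin t - (n:ℝ) * t = (x * Real.sin t - (n+1:ℕ) * t) + t := by push_cast; ring
      rw [this, Real.cos_add]; ring
    · apply Continuous.intervalIntegrable; fun_prop
    · apply Continuous.intervalIntegrable; fun_prop
  rw [this]; unfold besselJ
  push_cast at hb ⊢
  linear_combination (-1/π) * hb

lemma bj_diff (n : ℕ) (x : ℝ) : DifferentiableAt ℝ (besselJ n) x := (bj_hasDeriv_int n x).differentiableAt

lemma bj_cont (n : ℕ) : Continuous (besselJ n) :=
  continuous_iff_continuousAt.2 fun x => (bj_diff n x).continuousAt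

lemma bj_d1 (n : ℕ) {x : ℝ} (hx : 0 < x) :
    HasDerivAt (besselJ n) (n / x * besselJ n x - besselJ (n+1) x) x := by
  refine (bj_diff n x).hasDerivAt.congr_deriv ?_
  have := bj_rec1 n x
  field_simp; linarith

lemma bj_d2 (n : ℕ) {x : ℝ} (hx : 0 < x) :
    HasDerivAt (besselJ (n+1)) (besselJ n x - (n+1) / x * besselJ (n+1) x) x := by
  refine (bj_diff (n+1) x).hasDerivAt.congr_deriv ?_
  have := bj_rec2 n x
  field_simp; linarith

lemma bj_three (n : ℕ) {x : ℝ} (hx : 0 < x) :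
    besselJ n x + besselJ (n+2) x = 2 * (n+1) / x * besselJ (n+1) x := by
  have h1 := bj_rec1 (n+1) x
  have h2 := bj_rec2 n x
  push_cast at h1
  have h3 : x * (besselJ n x + besselJ (n+2) x) = 2 * (n+1) * besselJ (n+1) x := by linarith
  field_simp; linarith

/-- `K = x J'` written through the recurrence -/
noncomputable def bK (n : ℕ) (x : ℝ) : ℝ := n * besselJ n x - x * besselJ (n+1) x

lemma phi_eq (σ : ℝ) (n : ℕ) (x : ℝ) : phiRobin σ n x = bK n x + σ * besselJ n x := by
  unfold phiRobin besselJ' bK; rw [bj_rec1]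

lemma bj_dK1 (n : ℕ) {x : ℝ} (hx : 0 < x) : HasDerivAt (besselJ n) (bK n x / x) x := by
  refine (bj_d1 n hx).congr_deriv ?_; unfold bK; field_simp

lemma bK_d (n : ℕ) {x : ℝ} (hx : 0 < x) :
    HasDerivAt (bK n) ((n^2 - x^2) / x * besselJ n x) x := by
  unfold bK
  have := ((bj_d1 n hx).const_mul (n:ℝ)).sub ((hasDerivAt_id x).mul (bj_d2 n hx))
  refine this.congr_deriv ?_
  simp only [id]; field_simp; ring

lemma bK_cont (n : ℕ) : Continuous (bK n) := by
  unfold bK; have := bj_cont n; have := bj_cont (n+1); fun_prop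

lemma bj0_pos {x : ℝ} (h0 : 0 ≤ x) (h1 : x ≤ 1) : 0 < besselJ 0 x := by
  unfold besselJ
  apply mul_pos (by positivity)
  apply intervalIntegral.intervalIntegral_pos_of_pos
  · apply Continuous.intervalIntegrable; fun_prop
  · intro t
    apply Real.cos_pos_of_mem_Ioo
    have := Real.neg_one_le_sin t
    have := Real.sin_le_one t
    have := Real.pi_gt_three
    simp only [Nat.cast_zero, zero_mul, sub_zero]
    constructor <;> nlinarith
  · exact Real.pi_pos

lemma bj_pos (n : ℕ) {x : ℝ} (h0 : 0 < x) (h1 : x ≤ 1) : 0 < besselJ n x := by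
  induction n generalizing x with
  | zero => exact bj0_pos h0.le h1
  | succ n ih =>
    have hm : StrictMonoOn (fun x => x^(n+1) * besselJ (n+1) x) (Set.Icc 0 1) := by
      apply strictMonoOn_of_deriv_pos (convex_Icc 0 1)
      · have := bj_cont (n+1); fun_prop
      · intro y hy
        rw [interior_Icc] at hy
        have hd := ((hasDerivAt_pow (n+1) y).mul (bj_d2 n hy.1))
        have := ih hy.1 hy.2.le
        rw [show (fun x => x^(n+1) * besselJ (n+1) x) = ((fun x => x^(n+1)) * besselJ (n+1)) from rfl, hd.deriv]
        have hy1 := hy.1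
        have : 0 < y^(n+1) * besselJ n y := by positivity
        convert this using 1
        simp only [Nat.add_sub_cancel]
        push_cast
        field_simp
        ring
    have := hm (Set.left_mem_Icc.2 zero_le_one) ⟨h0.le, h1⟩ h0
    simp only [ne_eq, Nat.add_eq_zero_iff, one_ne_zero, and_false, not_false_eq_true, zero_pow, zero_mul] at this
    exact (mul_pos_iff_of_pos_left (by positivity)).1 this

lemma bj_zero_zero (n : ℕ) : bK n 0 = 0 := by
  unfold bK
  rw [← bj_rec1]; simp

lemma bJK_pos (n : ℕ) (hn : 1 ≤ n) {x : ℝ} (h0 : 0 < x) (h1 : x ≤ n) : 0 < besselJ n x ∧ 0 < bK n x := by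
  have hn' : (1:ℝ) ≤ n := by exact_mod_cast hn
  have hK : ∀ x : ℝ, 0 < x → x ≤ 1 → 0 < bK n x := by
    intro x h0 h1
    have hm : StrictMonoOn (bK n) (Set.Icc 0 1) := by
      apply strictMonoOn_of_deriv_pos (convex_Icc 0 1) (bK_cont n).continuousOn
      intro y hy
      rw [interior_Icc] at hy
      rw [(bK_d n hy.1).deriv]
      have := bj_pos n hy.1 hy.2.le
      have h2 : 0 < (n:ℝ)^2 - y^2 := by nlinarith [hy.1, hy.2]
      have := hy.1
      positivity
    have := hm (Set.left_mem_Icc.2 zero_le_one) ⟨h0.le, h1⟩ h0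
    rwa [bj_zero_zero n] at this
  have hmon : MonotoneOn (fun x => besselJ n x * bK n x) (Set.Icc 1 n) := by
    apply monotoneOn_of_deriv_nonneg (convex_Icc _ _)
    · exact ((bj_cont n).mul (bK_cont n)).continuousOn
    · intro y hy
      rw [interior_Icc] at hy
      have hy0 : 0 < y := by linarith [hy.1]
      exact ((bj_dK1 n hy0).mul (bK_d n hy0)).differentiableAt.differentiableWithinAt
    · intro y hy
      rw [interior_Icc] at hy
      have hy0 : 0 < y := by linarith [hy.1]
      rw [show (fun x => besselJ n x * bK n x) = (besselJ n * bK n) from rfl,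
        ((bj_dK1 n hy0).mul (bK_d n hy0)).deriv]
      have h2 : 0 ≤ (n:ℝ)^2 - y^2 := by nlinarith [hy.1, hy.2]
      have : bK n y / y * bK n y + besselJ n y * ((n^2 - y^2) / y * besselJ n y)
        = (bK n y ^ 2 + (n^2-y^2) * besselJ n y ^2) / y := by field_simp
      rw [this]; positivity
  have hJ1 := bj_pos n one_pos le_rfl
  have hK1 := hK 1 one_pos le_rfl
  have hprod : ∀ y : ℝ, 1 ≤ y → y ≤ n → 0 < besselJ n y * bK n y := by
    intro y hy1 hy2
    have := hmon ⟨le_rfl, hn'⟩ ⟨hy1, hy2⟩ hy1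
    have h2 := mul_pos hJ1 hK1
    simp only at this; linarith
  rcases le_total x 1 with h | h
  · exact ⟨bj_pos n h0 h, hK x h0 h⟩
  · have hJ : 0 < besselJ n x := by
      by_contra hneg
      push Not at hneg
      obtain ⟨z, hz, hz0⟩ := intermediate_value_Icc' h (bj_cont n).continuousOn ⟨hneg, hJ1.le⟩
      have := hprod z hz.1 (hz.2.trans h1)
      rw [hz0] at this; simp at this
    exact ⟨hJ, (mul_pos_iff_of_pos_left hJ).1 (hprod x h h1)⟩

/-- no common zeros -/
lemma bj_nocommon (n : ℕ) {x : ℝ} (hx : 0 < x) : besselJ n x ≠ 0 ∨ besselJ (n+1) x ≠ 0 := by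
  induction n with
  | zero =>
    rcases le_total x 1 with h | h
    · left; exact (bj0_pos hx.le h).ne'
    · have hmon : MonotoneOn (fun x => x^2 * (besselJ 0 x ^ 2 + besselJ 1 x ^ 2)) (Set.Ici 1) := by
        have hd : ∀ y : ℝ, 0 < y → HasDerivAt (fun x => x^2 * (besselJ 0 x ^ 2 + besselJ 1 x ^ 2))
            (2 * y * besselJ 0 y ^2) y := by
          intro y hy
          have := (hasDerivAt_pow 2 y).mul (((bj_d1 0 hy).pow 2).add ((bj_d2 0 hy).pow 2))
          refine this.congr_deriv ?_
          simp only [Nat.cast_zero, zero_add, Pi.add_apply, Pi.pow_apply]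
          push_cast
          field_simp; ring
        apply monotoneOn_of_deriv_nonneg (convex_Ici _)
        · have := bj_cont 0; have := bj_cont 1; fun_prop
        · intro y hy; rw [interior_Ici] at hy
          have hy0 : 0 < y := lt_trans one_pos hy
          exact (hd y hy0).differentiableAt.differentiableWithinAt
        · intro y hy; rw [interior_Ici] at hy
          have hy0 : 0 < y := lt_trans one_pos hy
          rw [(hd y hy0).deriv]; positivity
      have := hmon (Set.mem_Ici.2 le_rfl) (Set.mem_Ici.2 h) h
      by_contra hcon
      push Not at hcon
      simp only [zero_add] at hcon
      simp only [hcon.1, hcon.2] at this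
      have := bj0_pos zero_le_one le_rfl
      nlinarith [sq_nonneg (besselJ 1 1)]
  | succ n ih =>
    by_contra hcon
    push Not at hcon
    have := bj_three n hx
    rw [hcon.1, hcon.2] at this
    simp at this
    rcases ih with h | h
    · exact h this
    · exact h hcon.1


def IsLift (s : ℝ) (z z' : ℝ → ℂ) (θ : ℝ → ℝ) : Prop :=
  ∀ x, s < x → z x ≠ 0 ∧ HasDerivAt z (z' x) x ∧ HasDerivAt θ ((z' x / z x).im) x ∧
    z x = ‖z x‖ * Complex.exp (θ x * Complex.I)

lemma IsLift.mono {s s' : ℝ} {z z' : ℝ → ℂ} {θ : ℝ → ℝ} (h : IsLift s z z' θ) (hs : s ≤ s') :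
    IsLift s' z z' θ := fun x hx => h x (hs.trans_lt hx)

lemma IsLift.re {s : ℝ} {z z' : ℝ → ℂ} {θ : ℝ → ℝ} (h : IsLift s z z' θ) {x : ℝ} (hx : s < x) :
    (z x).re = ‖z x‖ * Real.cos (θ x) := by
  have := (h x hx).2.2.2
  have := congrArg Complex.re this
  rwa [Complex.re_ofReal_mul, Complex.exp_ofReal_mul_I_re] at this

lemma IsLift.im {s : ℝ} {z z' : ℝ → ℂ} {θ : ℝ → ℝ} (h : IsLift s z z' θ) {x : ℝ} (hx : s < x) :
    (z x).im = ‖z x‖ * Real.sin (θ x) := by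
  have := (h x hx).2.2.2
  have := congrArg Complex.im this
  rwa [Complex.im_ofReal_mul, Complex.exp_ofReal_mul_I_im] at this

lemma IsLift.pos {s : ℝ} {z z' : ℝ → ℂ} {θ : ℝ → ℝ} (h : IsLift s z z' θ) {x : ℝ} (hx : s < x) :
    0 < ‖z x‖ := norm_pos_iff.2 (h x hx).1

lemma IsLift.cont {s : ℝ} {z z' : ℝ → ℂ} {θ : ℝ → ℝ} (h : IsLift s z z' θ) {x : ℝ} (hx : s < x) :
    ContinuousAt θ x := (h x hx).2.2.1.continuousAt

lemma IsLift.transfer {s : ℝ} {z z' w w' : ℝ → ℂ} {η : ℝ → ℝ} (h : IsLift s z z' η)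
    (hw : ∀ x, s < x → HasDerivAt w (w' x) x)
    (hre : ∀ x, s < x → (w x).re = (z x).re)
    (him : ∀ x, s < x → (z x).re = 0 → 0 < (z x).im * (w x).im) :
    ∃ θ, IsLift s w w' θ ∧ ∀ x, s < x → |θ x - η x| < π := by
  have hslit : ∀ x, s < x → w x / z x ∈ Complex.slitPlane := by
    intro x hx
    have hz := (h x hx).1
    have hn : 0 < Complex.normSq (z x) := Complex.normSq_pos.2 hz
    rw [Complex.mem_slitPlane_iff, Complex.div_re, Complex.div_im, hre x hx]
    by_cases h0 : (z x).re = 0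
    · left
      have := him x hx h0
      have h2 := div_pos this hn
      rw [h0]; simp only [mul_zero, zero_div, zero_add]; rwa [mul_comm (w x).im]
    · by_cases h1 : (w x).im = (z x).im
      · left
        rw [h1]
        have : 0 < (z x).re * (z x).re := mul_self_pos.2 h0
        have h2 := mul_self_nonneg (z x).im
        have h3 := div_pos this hn
        have h4 := div_nonneg h2 hn.le
        linarith
      · right
        rw [← sub_div, div_ne_zero_iff]
        refine ⟨?_, hn.ne'⟩
        have : (w x).im * (z x).re - (z x).re * (z x).im = (z x).re * ((w x).im - (z x).im) := by ring
        rw [this]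
        exact mul_ne_zero h0 (sub_ne_zero.2 h1)
  refine ⟨fun x => η x + (Complex.log (w x / z x)).im, ?_, ?_⟩
  · intro x hx
    obtain ⟨hz, hdz, hdη, hze⟩ := h x hx
    have hs := hslit x hx
    have hq : w x / z x ≠ 0 := Complex.slitPlane_ne_zero hs
    have hw0 : w x ≠ 0 := by intro h0; simp [h0] at hq
    refine ⟨hw0, hw x hx, ?_, ?_⟩
    · have hd := ((hw x hx).div hdz hz).clog_real hs
      have hd2 : HasDerivAt (fun t => (Complex.log (w t / z t)).im)
          (((w' x * z x - w x * z' x) / z x ^ 2) / (w x / z x)).im x :=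
        (Complex.imCLM.hasFDerivAt.comp_hasDerivAt x hd)
      refine (hdη.add hd2).congr_deriv ?_
      rw [← Complex.add_im]
      congr 1
      field_simp
      ring
    · have h1 : w x / z x = ‖w x / z x‖ * Complex.exp ((Complex.log (w x / z x)).im * Complex.I) := by
        rw [Complex.log_im, Complex.norm_mul_exp_arg_mul_I]
      have h2 : w x = z x * (w x / z x) := by field_simp
      have h3 : ‖w x‖ = ‖z x‖ * ‖w x / z x‖ := by rw [← norm_mul, ← h2]
      rw [h3]
      have h4 : w x = (‖z x‖ * Complex.exp (η x * Complex.I)) *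
          (‖w x / z x‖ * Complex.exp ((Complex.log (w x / z x)).im * Complex.I)) := by
        rw [← hze, ← h1]; exact h2
      refine h4.trans ?_
      push_cast
      rw [add_mul, Complex.exp_add]
      ring
  · intro x hx
    simp only [add_sub_cancel_left, Complex.log_im]
    rw [abs_lt]
    have hs := hslit x hx
    refine ⟨Complex.neg_pi_lt_arg _, lt_of_le_of_ne (Complex.arg_le_pi _) ?_⟩
    exact Complex.mem_slitPlane_iff_arg.1 hs |>.1

/-- cell lemma (i) -/
lemma cell_i {a r1 r2 θ1 θ2 : ℝ} (hr1 : 0 < r1) (hr2 : 0 < r2)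
    (h1 : a = r1 * Real.cos θ1) (h2 : a = r2 * Real.cos θ2) (hd : |θ2 - θ1| < π) (j : ℤ)
    (hj : |θ1 - j * π| < π / 2) : |θ2 - j * π| < π / 2 := by
  have hπ := Real.pi_pos
  have hc1 : 0 < Real.cos (θ1 - j * π) := Real.cos_pos_of_mem_Ioo (abs_lt.1 hj)
  rw [Real.cos_sub_int_mul_pi] at hc1
  have hc2 : 0 < Real.cos (θ2 - j * π) := by
    rw [Real.cos_sub_int_mul_pi]
    have : (-1)^j * Real.cos θ2 = (r1 / r2) * ((-1)^j * Real.cos θ1) := by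
      field_simp; linear_combination h1 - h2
    rw [this]; positivity
  rw [abs_lt] at hj hd ⊢
  by_contra hcon
  have hneg : Real.cos (θ2 - j * π) ≤ 0 := by
    by_cases hlo : -(π/2) < θ2 - j * π
    · have : π/2 ≤ θ2 - j * π := by by_contra h; exact hcon ⟨hlo, not_le.1 h⟩
      apply Real.cos_nonpos_of_pi_div_two_le_of_le this; linarith
    · rw [← Real.cos_neg]
      apply Real.cos_nonpos_of_pi_div_two_le_of_le <;> linarith
  linarith

/-- cell lemma (ii) -/
lemma cell_ii {r1 r2 θ1 θ2 : ℝ} (hr1 : 0 < r1) (hr2 : 0 < r2)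
    (h1 : 0 = r1 * Real.cos θ1) (h2 : 0 = r2 * Real.cos θ2)
    (hd : |θ2 - θ1| < π) : θ2 = θ1 := by
  have c1 : Real.cos θ1 = 0 := by
    rcases mul_eq_zero.1 h1.symm with h | h
    · linarith
    · exact h
  have c2 : Real.cos θ2 = 0 := by
    rcases mul_eq_zero.1 h2.symm with h | h
    · linarith
    · exact h
  have hs : Real.sin (θ2 - θ1) = 0 := by rw [Real.sin_sub, c1, c2]; ring
  have := (Real.sin_eq_zero_iff_of_lt_of_lt (abs_lt.1 hd).1 (abs_lt.1 hd).2).1 hs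
  linarith

/-- cell lemma (iii) -/
lemma cell_iii {a b1 b2 r1 r2 θ χ ε : ℝ} (hr1 : 0 < r1) (hr2 : 0 < r2)
    (h1 : a = r1 * Real.cos θ) (h2 : a = r2 * Real.cos χ)
    (h1' : b1 = r1 * Real.sin θ) (h2' : b2 = r2 * Real.sin χ)
    (hd : |θ - χ| < π) (hε : 0 ≤ ε)
    (hyp : 0 ≤ b2 * a → -ε * a^2 ≤ b1 * a) (j : ℤ) (hj : j * π ≤ χ) : j * π - ε ≤ θ := by
  have hπ := Real.pi_pos
  by_contra hcon
  push Not at hcon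
  rw [abs_lt] at hd
  set e : ℝ := (-1)^j with he
  have he2 : e * e = 1 := by
    rw [he, ← mul_zpow]; simp
  have c1 : Real.cos (θ - j * π) = e * Real.cos θ := Real.cos_sub_int_mul_pi _ _
  have c2 : Real.cos (χ - j * π) = e * Real.cos χ := Real.cos_sub_int_mul_pi _ _
  have s1 : Real.sin (θ - j * π) = e * Real.sin θ := Real.sin_sub_int_mul_pi _ _
  have s2 : Real.sin (χ - j * π) = e * Real.sin χ := Real.sin_sub_int_mul_pi _ _
  set T := θ - j * π with hT
  set X := χ - j * π with hX
  have hX0 : 0 ≤ X := by linarith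
  have hT1 : T < -ε := by linarith
  have hTX : X - T < π := by linarith
  have hsX : 0 ≤ Real.sin X := Real.sin_nonneg_of_nonneg_of_le_pi hX0 (by linarith)
  have hA1 : e * a = r1 * Real.cos T := by rw [c1, h1]; ring
  have hA2 : e * a = r2 * Real.cos X := by rw [c2, h2]; ring
  rcases lt_or_ge X (π/2) with hlt | hge
  · have hcX : 0 < Real.cos X := Real.cos_pos_of_mem_Ioo ⟨by linarith, hlt⟩
    have hA : 0 < e * a := by rw [hA2]; positivity
    have hcT : 0 < Real.cos T := by
      rw [hA1] at hA; exact (mul_pos_iff_of_pos_left hr1).1 hA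
    have hT2 : -(π/2) < T := by
      by_contra h
      have : Real.cos T ≤ 0 := by
        rw [← Real.cos_neg]; apply Real.cos_nonpos_of_pi_div_two_le_of_le <;> linarith
      linarith
    have hb : b2 * a = (r2 * Real.sin X) * (e * a) := by
      rw [s2]; rw [h2']; linear_combination (-(r2 * Real.sin χ * a)) * he2
    have hh := hyp (by rw [hb]; positivity)
    have hb1 : b1 * a = (r1 * Real.sin T) * (e * a) := by
      rw [s1]; rw [h1']; linear_combination (-(r1 * Real.sin θ * a)) * he2
    have ha2 : a^2 = (r1 * Real.cos T) * (e * a) := by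
      rw [← hA1]; linear_combination (-a^2) * he2
    rw [hb1, ha2] at hh
    have h3 : -ε * Real.cos T ≤ Real.sin T := by
      have h4 : 0 ≤ (r1 * (e * a)) * (Real.sin T + ε * Real.cos T) := by linarith
      have h5 := (mul_nonneg_iff_of_pos_left (mul_pos hr1 hA)).1 h4
      linarith
    have h6 : -T < Real.tan (-T) := Real.lt_tan (by linarith) (by linarith)
    rw [Real.tan_eq_sin_div_cos, Real.sin_neg, Real.cos_neg, lt_div_iff₀ hcT] at h6
    nlinarith
  · have hT3 : T < 0 := by linarith
    have hcX : Real.cos X ≤ 0 := Real.cos_nonpos_of_pi_div_two_le_of_le hge (by linarith)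
    have hT2 : -(π/2) < T := by linarith
    have hcT : 0 < Real.cos T := Real.cos_pos_of_mem_Ioo ⟨hT2, by linarith⟩
    have := mul_pos hr1 hcT
    nlinarith

/-- staying in a cell while `cos ≠ 0` -/
lemma stay_cell {f : ℝ → ℝ} {a b : ℝ} (hf : ContinuousOn f (Set.uIcc a b))
    (hc : ∀ x ∈ Set.uIcc a b, Real.cos (f x) ≠ 0) (ha : |f a| < π / 2) : |f b| < π / 2 := by
  by_contra hcon
  have hiv := intermediate_value_uIcc (hf.abs)
  obtain ⟨x, hx, hxe⟩ := hiv (show π / 2 ∈ Set.uIcc |f a| |f b| from by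
    rw [Set.mem_uIcc]; left; exact ⟨ha.le, not_lt.1 hcon⟩)
  apply hc x hx
  simp only at hxe
  rw [← Real.cos_abs, hxe, Real.cos_pi_div_two]

/-- crossing lemma -/
lemma crossing {χ : ℝ → ℝ} {a x : ℝ} (hax : a ≤ x) (hmono : StrictMonoOn χ (Set.Ici a))
    (hcont : ContinuousOn χ (Set.Ici a)) (h0 : -π < χ a) (h1 : χ a < 0) :
    ({t : ℝ | t ∈ Set.Ioc a x ∧ Real.sin (χ t) = 0}).Finite ∧
    ∀ k : ℤ, 1 ≤ k → (k ≤ (({t : ℝ | t ∈ Set.Ioc a x ∧ Real.sin (χ t) = 0}).ncard : ℤ) ↔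
      (k - 1) * π ≤ χ x) := by
  have hπ := Real.pi_pos
  set Z := {t : ℝ | t ∈ Set.Ioc a x ∧ Real.sin (χ t) = 0} with hZ
  set F : Finset ℤ := Finset.Icc 0 ⌊χ x / π⌋ with hF
  have himg : (fun t => χ t / π) '' Z = (fun j : ℤ => (j:ℝ)) '' (F : Set ℤ) := by
    ext y
    simp only [Set.mem_image]
    constructor
    · rintro ⟨t, ⟨ht, hs⟩, rfl⟩
      obtain ⟨j, hj⟩ := Real.sin_eq_zero_iff.1 hs
      refine ⟨j, ?_, by rw [← hj]; field_simp⟩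
      rw [hF, Finset.coe_Icc, Set.mem_Icc]
      have hta : χ a < χ t := hmono (Set.mem_Ici.2 le_rfl) (Set.mem_Ici.2 ht.1.le) ht.1
      have htx : χ t ≤ χ x := hmono.monotoneOn (Set.mem_Ici.2 ht.1.le) (Set.mem_Ici.2 hax) ht.2
      constructor
      · have : (-1:ℝ) < j := by
          by_contra h
          push Not at h
          nlinarith
        have : (-1:ℤ) < j := by exact_mod_cast this
        omega
      · rw [Int.le_floor, le_div_iff₀ hπ, hj]; exact htx
    · rintro ⟨j, hj, rfl⟩
      rw [hF, Finset.coe_Icc, Set.mem_Icc, Int.le_floor, le_div_iff₀ hπ] at hj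
      have hj0 : (0:ℝ) ≤ j := by exact_mod_cast hj.1
      have hjp : 0 ≤ (j:ℝ) * π := by positivity
      obtain ⟨t, ht, hte⟩ := intermediate_value_Icc hax (hcont.mono Set.Icc_subset_Ici_self)
        (show (j:ℝ) * π ∈ Set.Icc (χ a) (χ x) from ⟨by linarith, hj.2⟩)
      refine ⟨t, ⟨⟨lt_of_le_of_ne ht.1 ?_, ht.2⟩, ?_⟩, by simp only [hte]; field_simp⟩
      · rintro rfl; linarith
      · rw [hte]; exact Real.sin_int_mul_pi j
  have hinj : Set.InjOn (fun t => χ t / π) Z := by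
    intro s hs t ht hst
    have : χ s = χ t := by simp only at hst; field_simp at hst; exact hst
    exact hmono.injOn (Set.mem_Ici.2 hs.1.1.le) (Set.mem_Ici.2 ht.1.1.le) this
  have hfin : Z.Finite := by
    apply Set.Finite.of_finite_image _ hinj
    rw [himg]; exact (Finset.finite_toSet F).image _
  refine ⟨hfin, ?_⟩
  have hcard : Z.ncard = F.card := by
    rw [← Set.InjOn.ncard_image hinj, himg, Set.ncard_image_of_injective _ Int.cast_injective,
      Set.ncard_coe_finset]
  intro k hk
  rw [hcard, hF, Int.card_Icc]
  have hk1 : 0 ≤ k - 1 := by omega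
  have : k ≤ ((⌊χ x / π⌋ + 1 - 0).toNat : ℤ) ↔ k - 1 ≤ ⌊χ x / π⌋ := by omega
  rw [this, Int.le_floor, le_div_iff₀ hπ]
  push_cast
  rfl


noncomputable def cur (f g : ℝ → ℝ) : ℝ → ℂ := fun x => (f x : ℂ) + g x * Complex.I

lemma cur_re (f g : ℝ → ℝ) (x : ℝ) : (cur f g x).re = f x := by simp [cur]
lemma cur_im (f g : ℝ → ℝ) (x : ℝ) : (cur f g x).im = g x := by simp [cur]

lemma cur_d {f g f' g' : ℝ → ℝ} {x : ℝ} (hf : HasDerivAt f (f' x) x) (hg : HasDerivAt g (g' x) x) :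
    HasDerivAt (cur f g) (cur f' g' x) x :=
  hf.ofReal_comp.add (hg.ofReal_comp.mul_const Complex.I)

lemma cur_q (f g f' g' : ℝ → ℝ) (x : ℝ) :
    (cur f' g' x / cur f g x).im = (f x * g' x - g x * f' x) / (f x ^ 2 + g x ^ 2) := by
  rw [Complex.div_im, Complex.normSq_apply]
  simp only [cur_re, cur_im]
  rw [← sub_div]; ring_nf

lemma cur_norm (f g : ℝ → ℝ) (x : ℝ) : ‖cur f g x‖ ^ 2 = f x ^ 2 + g x ^ 2 := by
  rw [← Complex.normSq_eq_norm_sq, Complex.normSq_apply]; simp only [cur_re, cur_im]; ring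

noncomputable def cP (n : ℕ) : ℝ → ℂ := cur (besselJ n) (besselJ (n+1))
noncomputable def cP' (n : ℕ) : ℝ → ℂ := cur (fun x => n / x * besselJ n x - besselJ (n+1) x)
  (fun x => besselJ n x - (n+1) / x * besselJ (n+1) x)

lemma cP_d (n : ℕ) {x : ℝ} (hx : 0 < x) : HasDerivAt (cP n) (cP' n x) x :=
  cur_d (bj_d1 n hx) (bj_d2 n hx)

lemma cP_ne (n : ℕ) {x : ℝ} (hx : 0 < x) : cP n x ≠ 0 := by
  intro h
  have h1 := congrArg Complex.re h
  have h2 := congrArg Complex.im h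
  simp only [cP, cur_re, cur_im, Complex.zero_re, Complex.zero_im] at h1 h2
  rcases bj_nocommon n hx with h | h <;> contradiction

lemma cP_base : ∃ η, IsLift 0 (cP 0) (cP' 0) η ∧ |η 1| < π / 2 := by
  have hcont : ContinuousOn (fun x => cP' 0 x / cP 0 x) (Set.Ioi 0) := by
    have h0 := bj_cont 0
    have h1 := bj_cont 1
    apply ContinuousOn.div
    · unfold cP' cur
      have : ContinuousOn (fun x : ℝ => x⁻¹) (Set.Ioi 0) :=
        continuousOn_inv₀.mono (fun x hx => (ne_of_gt hx))
      simp only [zero_add, div_eq_mul_inv, Nat.cast_zero, zero_mul, zero_sub, one_mul]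
      fun_prop
    · unfold cP cur; simp only [zero_add]; fun_prop
    · intro x hx; exact cP_ne 0 hx
  have hsub : ∀ {x : ℝ}, 0 < x → Set.uIcc 1 x ⊆ Set.Ioi 0 := by
    intro x hx y hy
    have := hy.1
    have h2 : 0 < min 1 x := lt_min one_pos hx
    exact lt_of_lt_of_le h2 this
  set L : ℝ → ℂ := fun x => ∫ t in (1:ℝ)..x, cP' 0 t / cP 0 t with hL
  have hLd : ∀ x, 0 < x → HasDerivAt L (cP' 0 x / cP 0 x) x := by
    intro x hx
    apply intervalIntegral.integral_hasDerivAt_right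
    · exact (hcont.mono (hsub hx)).intervalIntegrable
    · exact hcont.stronglyMeasurableAtFilter isOpen_Ioi x hx
    · exact hcont.continuousAt (Ioi_mem_nhds hx)
  have hconst : ∀ x, 0 < x → cP 0 x = cP 0 1 * Complex.exp (L x) := by
    have hd : ∀ x ∈ Set.Ioi (0:ℝ), HasDerivAt (fun x => cP 0 x * Complex.exp (-L x)) 0 x := by
      intro x hx
      refine ((cP_d 0 hx).mul (hLd x hx).neg.cexp).congr_deriv ?_
      have := cP_ne 0 hx
      field_simp
      ring
    intro x hx
    have := (convex_Ioi (0:ℝ)).is_const_of_fderivWithin_eq_zero (𝕜 := ℝ)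
      (f := fun x => cP 0 x * Complex.exp (-L x))
      (fun y hy => (hd y hy).differentiableAt.differentiableWithinAt)
      (fun y hy => by
        rw [fderivWithin_of_isOpen isOpen_Ioi hy]
        ext
        simpa using (hd y hy).deriv)
      hx (Set.mem_Ioi.2 (one_pos : (0:ℝ) < 1))
    have hL1 : L 1 = 0 := by simp [hL]
    simp only [hL1, neg_zero, Complex.exp_zero, mul_one] at this
    rw [← this, mul_assoc, ← Complex.exp_add]; simp
  refine ⟨fun x => Complex.arg (cP 0 1) + (L x).im, ?_, ?_⟩
  · intro x hx
    refine ⟨cP_ne 0 hx, cP_d 0 hx, ?_, ?_⟩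
    · have : HasDerivAt (fun t => (L t).im) ((cP' 0 x / cP 0 x).im) x :=
        Complex.imCLM.hasFDerivAt.comp_hasDerivAt x (hLd x hx)
      exact this.const_add _
    · have h1 := hconst x hx
      have h2 : Complex.exp (L x) = Real.exp ((L x).re) * Complex.exp ((L x).im * Complex.I) := by
        conv_lhs => rw [← Complex.re_add_im (L x)]
        rw [Complex.exp_add, Complex.ofReal_exp]
      have h3 : ‖cP 0 x‖ = ‖cP 0 1‖ * Real.exp ((L x).re) := by
        rw [h1, norm_mul, Complex.norm_exp]
      rw [h3, h1, h2]
      push_cast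
      rw [add_mul, Complex.exp_add]
      have h4 := Complex.norm_mul_exp_arg_mul_I (cP 0 1)
      conv_lhs => rw [← h4]
      ring
  · have hL1 : L 1 = 0 := by simp [hL]
    simp only [hL1, Complex.zero_im, add_zero]
    rw [Complex.abs_arg_lt_pi_div_two_iff]
    left
    simp only [cP, cur_re]
    exact bj0_pos zero_le_one le_rfl

lemma cP_step (n : ℕ) (η : ℝ → ℝ) (h : IsLift 0 (cP n) (cP' n) η) (h1 : |η 1| < π / 2) :
    ∃ η', (IsLift 0 (cP (n+1)) (cP' (n+1)) η' ∧ |η' 1| < π / 2) ∧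
      ∀ x, 0 < x → |η' x - (η x - π / 2)| < π := by
  have hI : IsLift 0 (fun x => -Complex.I * cP n x) (fun x => -Complex.I * cP' n x) (fun x => η x - π/2) := by
    intro x hx
    obtain ⟨a, b, c, d⟩ := h x hx
    refine ⟨mul_ne_zero (by simp) a, b.const_mul _, ?_, ?_⟩
    · refine (c.sub_const _).congr_deriv ?_
      rw [mul_div_mul_left _ _ (by simp)]
    · simp only [norm_mul, norm_neg, Complex.norm_I, one_mul]
      conv_lhs => rw [d]
      push_cast
      rw [sub_mul, Complex.exp_sub]
      have : (π / 2 : ℂ) * Complex.I = (π:ℂ) / 2 * Complex.I := rfl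
      rw [Complex.exp_pi_div_two_mul_I]
      field_simp
      rw [Complex.I_sq]; ring
  obtain ⟨η', hl, hd⟩ := hI.transfer (w := cP (n+1)) (w' := cP' (n+1)) (fun x hx => cP_d (n+1) hx)
    (by intro x hx; simp [cP, cur])
    (by
      intro x hx h0
      have h0' : besselJ (n+1) x = 0 := by simpa [cP, cur] using h0
      have h3 := bj_three n hx
      rw [h0'] at h3
      have h4 : besselJ (n+2) x = - besselJ n x := by linarith
      have h5 : besselJ n x ≠ 0 := by
        rcases bj_nocommon n hx with h | h
        · exact h
        · exact absurd h0' h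
      have : 0 < besselJ n x * besselJ n x := mul_self_pos.2 h5
      simp only [cP, cur_im]
      rw [show n + 1 + 1 = n + 2 from rfl, h4]
      simpa [cur] using this)
  refine ⟨η', ⟨hl, ?_⟩, hd⟩
  have hπ := Real.pi_pos
  have hd1 := hd 1 one_pos
  have hc := hl.re one_pos
  have hs := hl.im one_pos
  have hs0 := h.im one_pos
  simp only [cP, cur_re, cur_im] at hc hs hs0
  have hc' : 0 < Real.cos (η' 1) := by
    have := bj_pos (n+1) one_pos le_rfl
    rw [hc] at this; exact (mul_pos_iff_of_pos_left (hl.pos one_pos)).1 this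
  have hs' : 0 < Real.sin (η' 1) := by
    have := bj_pos (n+1+1) one_pos le_rfl
    rw [hs] at this; exact (mul_pos_iff_of_pos_left (hl.pos one_pos)).1 this
  rw [abs_lt] at h1 hd1 ⊢
  have hη0 : 0 < η 1 := by
    by_contra hcon
    push Not at hcon
    have h2 := Real.sin_nonpos_of_nonpos_of_neg_pi_le hcon (by linarith)
    have h3 := bj_pos (n+1) one_pos le_rfl
    rw [hs0] at h3
    have h4 := (mul_pos_iff_of_pos_left (h.pos one_pos)).1 h3
    linarith
  constructor
  · by_contra hcon
    push Not at hcon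
    rcases le_total (-π) (η' 1) with h | h
    · have := Real.sin_nonpos_of_nonpos_of_neg_pi_le (x := η' 1) (by linarith) h; linarith
    · have : Real.cos (η' 1) ≤ 0 := by
        rw [← Real.cos_neg]
        apply Real.cos_nonpos_of_pi_div_two_le_of_le <;> linarith
      linarith
  · by_contra hcon
    push Not at hcon
    have := Real.cos_nonpos_of_pi_div_two_le_of_le hcon (by linarith)
    linarith

lemma cP_seq : ∃ η : ℕ → ℝ → ℝ, (∀ n, IsLift 0 (cP n) (cP' n) (η n) ∧ |η n 1| < π / 2) ∧
    ∀ n x, 0 < x → |η (n+1) x - (η n x - π / 2)| < π := by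
  choose! step hstep using fun n η (h : IsLift 0 (cP n) (cP' n) η ∧ |η 1| < π / 2) =>
    cP_step n η h.1 h.2
  obtain ⟨η0, h0⟩ := cP_base
  let s : ℕ → ℝ → ℝ := fun n => Nat.rec η0 (fun n η => step n η) n
  have hs : ∀ n, IsLift 0 (cP n) (cP' n) (s n) ∧ |s n 1| < π / 2 := by
    intro n
    induction n with
    | zero => exact h0
    | succ n ih => exact (hstep n (s n) ih).1
  exact ⟨s, hs, fun n => (hstep n (s n) (hs n)).2⟩

noncomputable def cS (σ : ℝ) (n : ℕ) : ℝ → ℂ := cur (besselJ n) (fun x => -(bK n x + σ * besselJ n x))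
noncomputable def cS' (σ : ℝ) (n : ℕ) : ℝ → ℂ := cur (fun x => bK n x / x)
  (fun x => -((n^2 - x^2) / x * besselJ n x + σ * (bK n x / x)))

lemma cS_d (σ : ℝ) (n : ℕ) {x : ℝ} (hx : 0 < x) : HasDerivAt (cS σ n) (cS' σ n x) x :=
  cur_d (bj_dK1 n hx) ((bK_d n hx).add ((bj_dK1 n hx).const_mul σ)).neg

lemma bJK_ne (n : ℕ) {x : ℝ} (hx : 0 < x) (h : besselJ n x = 0) : bK n x ≠ 0 := by
  unfold bK
  rcases bj_nocommon n hx with h1 | h1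
  · contradiction
  · rw [h]; simp only [mul_zero, zero_sub, neg_ne_zero]; exact mul_ne_zero hx.ne' h1

lemma chi_exists (σ : ℝ) (n : ℕ) {η : ℝ → ℝ} (h : IsLift 0 (cP n) (cP' n) η) :
    ∃ χ, IsLift 0 (cS σ n) (cS' σ n) χ ∧ ∀ x, 0 < x → |χ x - η x| < π := by
  apply h.transfer (fun x hx => cS_d σ n hx)
  · intro x hx; simp [cP, cS, cur]
  · intro x hx h0
    simp only [cP, cS, cur_re, cur_im] at h0 ⊢
    have h1 : besselJ (n+1) x ≠ 0 := by
      rcases bj_nocommon n hx with h | h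
      · contradiction
      · exact h
    have : 0 < x * (besselJ (n+1) x * besselJ (n+1) x) := mul_pos hx (mul_self_pos.2 h1)
    unfold bK; rw [h0]
    linarith

noncomputable def pp (n : ℕ) (x : ℝ) : ℝ := Real.sqrt (x^2 - n^2)

lemma pp_pos {n : ℕ} {x : ℝ} (hx : (n:ℝ) < x) : 0 < pp n x := by
  unfold pp; apply Real.sqrt_pos.2
  have : (0:ℝ) ≤ n := Nat.cast_nonneg n
  nlinarith

lemma pp_sq {n : ℕ} {x : ℝ} (hx : (n:ℝ) < x) : pp n x ^ 2 = x^2 - n^2 := by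
  unfold pp; apply Real.sq_sqrt
  have : (0:ℝ) ≤ n := Nat.cast_nonneg n
  nlinarith

lemma pp_d {n : ℕ} {x : ℝ} (hx : (n:ℝ) < x) : HasDerivAt (pp n) (x / pp n x) x := by
  have h1 : HasDerivAt (fun x : ℝ => x^2 - (n:ℝ)^2) (2 * x) x := by
    simpa using (hasDerivAt_pow 2 x).sub_const ((n:ℝ)^2)
  have hp := pp_pos hx
  have := h1.sqrt (by rw [← pp_sq hx]; positivity)
  refine this.congr_deriv ?_
  unfold pp; field_simp

noncomputable def cQ (n : ℕ) : ℝ → ℂ := cur (besselJ n)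
  (fun x => -(bK n x / pp n x + x^2 * besselJ n x / (2 * pp n x ^ 3)))
noncomputable def cQ' (n : ℕ) : ℝ → ℂ := cur (fun x => bK n x / x)
  (fun x => -(((n^2 - x^2) / x * besselJ n x) / pp n x - bK n x * (x / pp n x) / pp n x ^ 2
    + (2 * x * besselJ n x + x^2 * (bK n x / x)) / (2 * pp n x ^ 3)
    - (x^2 * besselJ n x) * (6 * pp n x ^2 * (x / pp n x)) / (2 * pp n x ^ 3)^2))

lemma cQ_d (n : ℕ) {x : ℝ} (hx : (n:ℝ) < x) : HasDerivAt (cQ n) (cQ' n x) x := by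
  have hx0 : 0 < x := lt_of_le_of_lt (Nat.cast_nonneg n) hx
  have hp := pp_pos hx
  apply cur_d (bj_dK1 n hx0)
  have h1 := (bK_d n hx0).div (pp_d hx) hp.ne'
  have h2 := ((hasDerivAt_pow 2 x).mul (bj_dK1 n hx0)).div (((pp_d hx).pow 3).const_mul 2)
    (by simp only [Pi.pow_apply]; positivity)
  refine (h1.add h2).neg.congr_deriv ?_
  simp only [Pi.mul_apply, Pi.pow_apply]
  push_cast
  field_simp
  ring

lemma theta_exists (σ : ℝ) (n : ℕ) {χ : ℝ → ℝ} (h : IsLift 0 (cS σ n) (cS' σ n) χ) :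
    ∃ θ, IsLift n (cQ n) (cQ' n) θ ∧ ∀ x, (n:ℝ) < x → |θ x - χ x| < π := by
  apply (h.mono (Nat.cast_nonneg n)).transfer (fun x hx => cQ_d n hx)
  · intro x hx; simp only [cQ, cS, cur_re]
  · intro x hx h0
    simp only [cQ, cS, cur_re, cur_im] at h0 ⊢
    have hx0 : 0 < x := lt_of_le_of_lt (Nat.cast_nonneg n) hx
    have h1 := bJK_ne n hx0 h0
    rw [h0]
    have : 0 < bK n x * bK n x / pp n x := div_pos (mul_self_pos.2 h1) (pp_pos hx)
    simp only [mul_zero, add_zero, zero_div]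
    convert this using 1; ring

/-- monotonicity of chi -/
lemma chi_deriv_pos (σ : ℝ) (n : ℕ) {x : ℝ} (hx : (n:ℝ) < x) : 0 < (cS' σ n x / cS σ n x).im := by
  have hx0 : 0 < x := lt_of_le_of_lt (Nat.cast_nonneg n) hx
  have hn : (0:ℝ) ≤ n := Nat.cast_nonneg n
  have h2 : 0 < x^2 - (n:ℝ)^2 := by nlinarith
  unfold cS cS'
  rw [cur_q]
  have hne : besselJ n x ≠ 0 ∨ bK n x ≠ 0 := by
    by_cases h : besselJ n x = 0
    · right; exact bJK_ne n hx0 h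
    · left; exact h
  apply div_pos
  · have : besselJ n x * -((n^2 - x^2) / x * besselJ n x + σ * (bK n x / x))
      - -(bK n x + σ * besselJ n x) * (bK n x / x) = ((x^2 - n^2) * besselJ n x ^2 + bK n x ^2) / x := by
      field_simp; ring
    rw [this]
    apply div_pos _ hx0
    rcases hne with h | h <;> positivity
  · rcases eq_or_ne (besselJ n x) 0 with h | h
    · have := bJK_ne n hx0 h
      rw [h]; simp only [mul_zero, add_zero]
      have h3 : 0 < bK n x ^ 2 := by positivity
      nlinarith
    · positivity

/-- WKB bound -/
lemma theta_deriv (n : ℕ) {x : ℝ} (hx : (n:ℝ) < x) :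
    |(cQ' n x / cQ n x).im - pp n x / x| ≤
      pp n x / x * |5/4 * x^4 / pp n x ^ 6 - x^2 / pp n x ^ 4| := by
  have hx0 : 0 < x := lt_of_le_of_lt (Nat.cast_nonneg n) hx
  have hp := pp_pos hx
  have hp2 := pp_sq hx
  unfold cQ cQ'
  rw [cur_q]
  set J := besselJ n x with hJ
  set K := bK n x with hK
  set p := pp n x with hpdef
  set B := -(K / p + x^2 * J / (2 * p ^ 3)) with hB
  have hpos : 0 < J^2 + B^2 := by
    rcases eq_or_ne J 0 with h | h
    · have h1 := bJK_ne n hx0 h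
      have : B ≠ 0 := by
        rw [hB, h]; simp only [mul_zero, zero_div, add_zero, neg_ne_zero]
        exact div_ne_zero h1 hp.ne'
      positivity
    · positivity
  have hn2 : (n:ℝ)^2 = x^2 - p^2 := by linarith
  have key : (J * -(((n^2 - x^2) / x * J) / p - K * (x / p) / p ^ 2
    + (2 * x * J + x^2 * (K / x)) / (2 * p ^ 3)
    - (x^2 * J) * (6 * p ^2 * (x / p)) / (2 * p ^ 3)^2) - B * (K / x)) / (J^2 + B^2) - p / x
    = p / x * (5/4 * x^4 / p ^ 6 - x^2 / p ^ 4) * (J^2 / (J^2 + B^2)) := by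
    rw [div_sub' hpos.ne', ← mul_div_assoc]
    rw [hn2, hB]
    field_simp
    ring
  rw [key, abs_mul, abs_mul, abs_of_pos (div_pos hp hx0)]
  have h1 : |J^2 / (J^2 + B^2)| ≤ 1 := by
    rw [abs_of_nonneg (by positivity), div_le_one hpos]; nlinarith [sq_nonneg B]
  exact mul_le_of_le_one_right (by positivity) h1


lemma ibp_osc (ψ ψ' b b' : ℝ → ℝ) (β : ℝ) (hβ : 0 ≤ β)
    (hψ : ∀ t ∈ Set.Icc 0 β, HasDerivAt ψ (ψ' t) t) (hb : ∀ t ∈ Set.Icc 0 β, HasDerivAt b (b' t) t)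
    (hψc : ContinuousOn ψ' (Set.Icc 0 β)) (hbc : ContinuousOn b' (Set.Icc 0 β)) :
    ∃ C : ℝ, 0 ≤ C ∧ ∀ x : ℝ, 0 < x →
      ‖∫ t in (0:ℝ)..β, Complex.exp (-(Complex.I * x * ψ t)) * (ψ' t * b t : ℝ)‖ ≤ C / x := by
  refine ⟨|b β| + |b 0| + ∫ t in (0:ℝ)..β, |b' t|, ?_, ?_⟩
  · have := intervalIntegral.integral_nonneg (f := fun t => |b' t|) (μ := volume) hβ (fun t _ => abs_nonneg _)
    positivity
  intro x hx
  have hu : Set.uIcc 0 β = Set.Icc 0 β := Set.uIcc_of_le hβ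
  set E : ℝ → ℂ := fun t => Complex.exp (-(Complex.I * x * ψ t)) with hE
  have hEn : ∀ t, ‖E t‖ = 1 := by
    intro t
    rw [hE]
    have : -(Complex.I * x * ψ t) = ((-(x * ψ t) : ℝ) : ℂ) * Complex.I := by push_cast; ring
    simp only [this, Complex.norm_exp_ofReal_mul_I]
  have hEd : ∀ t ∈ Set.Icc 0 β, HasDerivAt E (E t * (-(Complex.I * x * ψ' t))) t := by
    intro t ht
    exact (((hψ t ht).ofReal_comp.const_mul (Complex.I * x)).neg).cexp
  have hEc : ContinuousOn E (Set.Icc 0 β) := fun t ht => (hEd t ht).continuousAt.continuousWithinAt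
  have hbcont : ContinuousOn b (Set.Icc 0 β) := fun t ht => (hb t ht).continuousAt.continuousWithinAt
  have i1 : IntervalIntegrable (fun t => E t * (ψ' t * b t : ℝ)) volume 0 β := by
    apply ContinuousOn.intervalIntegrable; rw [hu]
    exact hEc.mul (Complex.continuous_ofReal.comp_continuousOn (hψc.mul hbcont))
  have i2 : IntervalIntegrable (fun t => E t * (b' t : ℝ)) volume 0 β := by
    apply ContinuousOn.intervalIntegrable; rw [hu]
    exact hEc.mul (Complex.continuous_ofReal.comp_continuousOn hbc)
  have hFTC := intervalIntegral.integral_eq_sub_of_hasDerivAt (a := 0) (b := β)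
    (f := fun t => E t * (b t : ℂ))
    (f' := fun t => (-(Complex.I * x)) * (E t * (ψ' t * b t : ℝ)) + E t * (b' t : ℝ))
    (by
      intro t ht
      rw [hu] at ht
      refine ((hEd t ht).mul (hb t ht).ofReal_comp).congr_deriv ?_
      push_cast; ring)
    ((i1.const_mul _).add i2)
  rw [intervalIntegral.integral_add (i1.const_mul _) i2, intervalIntegral.integral_const_mul] at hFTC
  have h1 : (Complex.I * x) * ∫ t in (0:ℝ)..β, E t * (ψ' t * b t : ℝ)
      = (∫ t in (0:ℝ)..β, E t * (b' t : ℝ)) - (E β * b β - E 0 * b 0) := by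
    rw [← hFTC]; ring
  have h2 : ‖∫ t in (0:ℝ)..β, E t * (b' t : ℝ)‖ ≤ ∫ t in (0:ℝ)..β, |b' t| := by
    refine (intervalIntegral.norm_integral_le_integral_norm hβ).trans (le_of_eq ?_)
    congr 1; ext t; rw [norm_mul, hEn, one_mul, Complex.norm_real, Real.norm_eq_abs]
  have h3 := congrArg norm h1
  rw [norm_mul, norm_mul, Complex.norm_I, one_mul, Complex.norm_real, Real.norm_eq_abs, abs_of_pos hx] at h3
  have h4 : ‖E β * (b β : ℂ)‖ = |b β| := by rw [norm_mul, hEn, one_mul, Complex.norm_real, Real.norm_eq_abs]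
  have h5 : ‖E 0 * (b 0 : ℂ)‖ = |b 0| := by rw [norm_mul, hEn, one_mul, Complex.norm_real, Real.norm_eq_abs]
  have h6 := norm_sub_le (∫ t in (0:ℝ)..β, E t * (b' t : ℝ)) (E β * b β - E 0 * b 0)
  have h7 := norm_sub_le (E β * (b β:ℂ)) (E 0 * b 0)
  rw [le_div_iff₀ hx, mul_comm, h3]
  linarith

noncomputable def fF (X : ℝ) : ℂ := ∫ v in (0:ℝ)..X, Complex.exp (-(Complex.I * (v:ℂ)^2))
noncomputable def fH (X : ℝ) : ℂ := ∫ u in (0:ℝ)..1, Complex.exp (-(Complex.I * (X:ℂ)^2 * (1 + (u:ℂ)^2))) / (1 + (u:ℂ)^2)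

lemma one_add_sq_ne (u : ℝ) : (1 + (u:ℂ)^2) ≠ 0 := by
  have : (1 + (u:ℂ)^2) = ((1 + u^2 : ℝ) : ℂ) := by push_cast; ring
  rw [this]; exact_mod_cast (by positivity : (1 + u^2 : ℝ) ≠ 0)

lemma fF_d (X : ℝ) : HasDerivAt fF (Complex.exp (-(Complex.I * (X:ℂ)^2))) X := by
  have hc : Continuous (fun v : ℝ => Complex.exp (-(Complex.I * (v:ℂ)^2))) := by fun_prop
  exact intervalIntegral.integral_hasDerivAt_right (hc.intervalIntegrable _ _)
    hc.aestronglyMeasurable.stronglyMeasurableAtFilter hc.continuousAt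

lemma fF_scale (X : ℝ) : (X:ℂ) * ∫ u in (0:ℝ)..1, Complex.exp (-(Complex.I * (X:ℂ)^2 * (u:ℂ)^2)) = fF X := by
  have := intervalIntegral.smul_integral_comp_mul_left (a := 0) (b := 1)
    (fun v : ℝ => Complex.exp (-(Complex.I * (v:ℂ)^2))) X
  rw [mul_zero, mul_one] at this
  unfold fF
  rw [← this, Complex.real_smul]
  congr 2; ext u; push_cast; ring_nf

lemma norm_expI (r : ℝ) : ‖Complex.exp (-(Complex.I * r))‖ = 1 := by
  have : -(Complex.I * r) = ((-r : ℝ) : ℂ) * Complex.I := by push_cast; ring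
  rw [this, Complex.norm_exp_ofReal_mul_I]

lemma fH_d (X : ℝ) : HasDerivAt fH (-(2 * Complex.I) * (Complex.exp (-(Complex.I * (X:ℂ)^2)) * fF X)) X := by
  have hcont : ∀ y : ℝ, Continuous (fun u : ℝ => Complex.exp (-(Complex.I * (y:ℂ)^2 * (1 + (u:ℂ)^2))) / (1 + (u:ℂ)^2)) := by
    intro y
    apply Continuous.div (by fun_prop) (by fun_prop)
    exact one_add_sq_ne
  have := intervalIntegral.hasDerivAt_integral_of_dominated_loc_of_deriv_le (𝕜 := ℝ) (μ := volume)
    (F := fun (y:ℝ) (u:ℝ) => Complex.exp (-(Complex.I * (y:ℂ)^2 * (1 + (u:ℂ)^2))) / (1 + (u:ℂ)^2))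
    (F' := fun (y:ℝ) (u:ℝ) => -(2 * Complex.I * y) * Complex.exp (-(Complex.I * (y:ℂ)^2 * (1 + (u:ℂ)^2))))
    (x₀ := X) (s := Metric.ball X 1) (a := 0) (b := 1) (bound := fun _ => 2 * (|X| + 1)) (Metric.ball_mem_nhds X one_pos)
    (Filter.Eventually.of_forall fun y => (hcont y).aestronglyMeasurable)
    ((hcont X).intervalIntegrable _ _)
    ((by fun_prop : Continuous _).aestronglyMeasurable)
    (by
      refine Filter.Eventually.of_forall fun t _ y hy => ?_
      have h1 : ‖Complex.exp (-(Complex.I * (y:ℂ)^2 * (1 + (t:ℂ)^2)))‖ = 1 := by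
        have : -(Complex.I * (y:ℂ)^2 * (1 + (t:ℂ)^2)) = -(Complex.I * ((y^2 * (1 + t^2) : ℝ):ℂ)) := by push_cast; ring
        rw [this, norm_expI]
      rw [norm_mul, h1, mul_one, norm_neg, norm_mul, norm_mul, Complex.norm_I, mul_one, Complex.norm_real,
        Real.norm_eq_abs]
      simp only [Complex.norm_ofNat]
      rw [Metric.mem_ball, Real.dist_eq] at hy
      have : |y| ≤ |X| + |y - X| := by
        have := abs_add_le X (y - X); simpa using this
      linarith)
    (by simp)
    (by
      refine Filter.Eventually.of_forall fun t _ y _ => ?_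
      have h0 : HasDerivAt (fun y : ℝ => (y:ℂ)) 1 y := Complex.ofRealCLM.hasDerivAt
      have h : HasDerivAt (fun y : ℝ => -(Complex.I * (y:ℂ)^2 * (1 + (t:ℂ)^2))) 
          (-(2 * Complex.I * y * (1 + (t:ℂ)^2))) y := by
        refine ((((h0.pow 2).const_mul Complex.I).mul_const (1 + (t:ℂ)^2)).neg).congr_deriv ?_
        push_cast; ring
      refine (h.cexp.div_const (1 + (t:ℂ)^2)).congr_deriv ?_
      have := one_add_sq_ne t
      field_simp)
  refine this.2.congr_deriv ?_
  rw [← fF_scale X, intervalIntegral.integral_const_mul]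
  have : ∀ u : ℝ, Complex.exp (-(Complex.I * (X:ℂ)^2 * (1 + (u:ℂ)^2))) = 
      Complex.exp (-(Complex.I * (X:ℂ)^2)) * Complex.exp (-(Complex.I * (X:ℂ)^2 * (u:ℂ)^2)) := by
    intro u; rw [← Complex.exp_add]; congr 1; ring
  simp_rw [this]
  rw [intervalIntegral.integral_const_mul]
  ring

lemma fF_sq (X : ℝ) : fF X ^ 2 = Complex.I * (fH X - π / 4) := by
  have hd : ∀ y : ℝ, HasDerivAt (fun y => fF y ^ 2 - Complex.I * fH y) 0 y := by
    intro y
    refine (((fF_d y).pow 2).sub ((fH_d y).const_mul Complex.I)).congr_deriv ?_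
    push_cast
    linear_combination (2 * (Complex.exp (-(Complex.I * (y:ℂ)^2)) * fF y)) * Complex.I_sq
  have hc := is_const_of_deriv_eq_zero (fun y => (hd y).differentiableAt) (fun y => (hd y).deriv) X 0
  have hF0 : fF 0 = 0 := by simp [fF]
  have hH0 : fH 0 = π / 4 := by
    unfold fH
    have : ∀ u : ℝ, Complex.exp (-(Complex.I * ((0:ℝ):ℂ)^2 * (1 + (u:ℂ)^2))) / (1 + (u:ℂ)^2) = ((1 / (1 + u^2) : ℝ) : ℂ) := by
      intro u; push_cast; simp
    simp_rw [this]
    rw [intervalIntegral.integral_ofReal, integral_one_div_one_add_sq]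
    simp
  simp only [hF0, hH0] at hc
  linear_combination hc

lemma fH_bound (X : ℝ) : ‖fH X‖ ≤ 1 := by
  unfold fH
  have := intervalIntegral.norm_integral_le_of_norm_le_const (a := 0) (b := 1) (C := 1)
    (f := fun u : ℝ => Complex.exp (-(Complex.I * (X:ℂ)^2 * (1 + (u:ℂ)^2))) / (1 + (u:ℂ)^2))
    (by
      intro u _
      rw [norm_div]
      have h1 : -(Complex.I * (X:ℂ)^2 * (1 + (u:ℂ)^2)) = -(Complex.I * ((X^2 * (1 + u^2) : ℝ):ℂ)) := by push_cast; ring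
      have h2 : (1 + (u:ℂ)^2) = ((1 + u^2 : ℝ) : ℂ) := by push_cast; ring
      rw [h1, norm_expI, h2, Complex.norm_real, Real.norm_eq_abs, abs_of_pos (by positivity)]
      rw [div_le_one (by positivity)]; nlinarith [sq_nonneg u])
  simpa using this

lemma fF_bound (X : ℝ) : ‖fF X‖ ≤ 2 := by
  have h1 : ‖fF X‖ ^ 2 ≤ 2 := by
    rw [← norm_pow, fF_sq, norm_mul, Complex.norm_I, one_mul]
    refine (norm_sub_le _ _).trans ?_
    have h2 : ‖(π / 4 : ℂ)‖ = π / 4 := by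
      rw [show (π / 4 : ℂ) = ((π/4 : ℝ) : ℂ) by push_cast; rfl, Complex.norm_real, Real.norm_eq_abs, abs_of_pos (by positivity)]
    rw [h2]
    linarith [fH_bound X, Real.pi_lt_four]
  nlinarith [norm_nonneg (fF X)]

lemma fH_tendsto : Filter.Tendsto fH Filter.atTop (nhds 0) := by
  obtain ⟨C, hC0, hC⟩ := ibp_osc (fun u => u^2) (fun u => 2 * u) (fun u => u / (2 * (1 + u^2)))
    (fun u => (1 * (2 * (1 + u^2)) - u * (2 * (2 * u))) / (2 * (1 + u^2))^2) 1 zero_le_one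
    (by intro t _; simpa using hasDerivAt_pow 2 t)
    (by
      intro t _
      have h1 : HasDerivAt (fun u : ℝ => 2 * (1 + u^2)) (2 * (2 * t)) t := by
        have := ((hasDerivAt_pow 2 t).const_add 1).const_mul 2
        simpa using this
      exact (hasDerivAt_id t).div h1 (by positivity))
    (by fun_prop)
    (by
      apply Continuous.continuousOn
      apply Continuous.div (by fun_prop) (by fun_prop)
      intro u; positivity)
  have hle : ∀ X : ℝ, 1 ≤ X → ‖fH X‖ ≤ (2 + C) / X := by
    intro X hX
    have hX0 : 0 < X := by linarith
    have key : (X:ℂ) * fH X = Complex.exp (-(Complex.I * (X:ℂ)^2)) * (fF X - X * 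
        ∫ t in (0:ℝ)..1, Complex.exp (-(Complex.I * ((X^2:ℝ):ℂ) * ((t^2:ℝ):ℂ))) * (2 * t * (t / (2 * (1 + t^2))) : ℝ)) := by
      rw [← fF_scale, ← mul_sub, ← intervalIntegral.integral_sub, mul_left_comm, ← intervalIntegral.integral_const_mul]
      · unfold fH
        congr 2; ext u
        have h1 := one_add_sq_ne u
        have : Complex.exp (-(Complex.I * (X:ℂ)^2 * (1 + (u:ℂ)^2))) = 
          Complex.exp (-(Complex.I * (X:ℂ)^2)) * Complex.exp (-(Complex.I * (X:ℂ)^2 * (u:ℂ)^2)) := by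
          rw [← Complex.exp_add]; congr 1; ring
        rw [this]
        push_cast
        field_simp
        ring
      · apply Continuous.intervalIntegrable; fun_prop
      · apply Continuous.intervalIntegrable
        apply Continuous.mul (by fun_prop)
        apply Complex.continuous_ofReal.comp
        apply Continuous.mul (by fun_prop)
        apply Continuous.div (by fun_prop) (by fun_prop)
        intro u; positivity
    have h2 := congrArg norm key
    have h3 := norm_expI (X^2)
    push_cast at h3
    rw [norm_mul, norm_mul, h3, one_mul, Complex.norm_real, Real.norm_eq_abs, abs_of_pos hX0] at h2
    have h4 := hC (X^2) (by positivity)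
    have h5 := norm_sub_le (fF X) (X * ∫ t in (0:ℝ)..1, Complex.exp (-(Complex.I * ((X^2:ℝ):ℂ) * ((t^2:ℝ):ℂ))) * (2 * t * (t / (2 * (1 + t^2))) : ℝ))
    rw [norm_mul, Complex.norm_real, Real.norm_eq_abs, abs_of_pos hX0] at h5
    rw [le_div_iff₀ hX0, mul_comm, h2]
    refine h5.trans ?_
    have h6 : X * (C / X^2) ≤ C := by
      rw [show X * (C / X^2) = C / X by field_simp]
      exact div_le_self hC0 hX
    have h7 := mul_le_mul_of_nonneg_left h4 hX0.le
    linarith [fF_bound X]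
  apply squeeze_zero_norm' (a := fun X => (2 + C) / X)
  · filter_upwards [Filter.eventually_ge_atTop 1] with X hX using hle X hX
  · exact Filter.Tendsto.div_atTop tendsto_const_nhds Filter.tendsto_id

lemma fF_sq_tendsto : Filter.Tendsto (fun X => fF X ^ 2) Filter.atTop (nhds (-(Complex.I * (π/4)))) := by
  have := (fH_tendsto.sub_const ((π:ℂ)/4)).const_mul Complex.I
  simp only [zero_sub, mul_neg] at this
  refine this.congr fun X => (fF_sq X).symm

noncomputable def fG (x : ℝ) : ℂ := ∫ t in (0:ℝ)..(π/2), Complex.exp (-(Complex.I * x * ((1 - Real.cos t : ℝ):ℂ)))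

lemma bj0_G (x : ℝ) : besselJ 0 x = (2/π) * (Complex.exp (Complex.I * x) * fG x).re := by
  have h1 : (Complex.exp (Complex.I * x) * fG x).re = ∫ t in (0:ℝ)..(π/2), Real.cos (x * Real.cos t) := by
    unfold fG
    rw [← intervalIntegral.integral_const_mul]
    have hc : IntervalIntegrable (fun t : ℝ => Complex.exp (Complex.I * x) * Complex.exp (-(Complex.I * x * ((1 - Real.cos t : ℝ):ℂ)))) volume 0 (π/2) := by
      apply Continuous.intervalIntegrable; fun_prop
    have := Complex.reCLM.intervalIntegral_comp_comm hc
    simp only [Complex.reCLM_apply] at this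
    rw [← this]
    congr 1; ext t
    rw [← Complex.exp_add]
    have : Complex.I * x + -(Complex.I * x * ((1 - Real.cos t : ℝ):ℂ)) = ((x * Real.cos t : ℝ):ℂ) * Complex.I := by
      push_cast; ring
    rw [this, Complex.exp_ofReal_mul_I_re]
  rw [h1]
  unfold besselJ
  have h2 : ∫ t in (0:ℝ)..π, Real.cos (x * Real.sin t - (0:ℕ) * t) = ∫ s in (-(π/2))..(π/2), Real.cos (x * Real.cos s) := by
    have := intervalIntegral.integral_comp_add_right (a := -(π/2)) (b := π/2) (fun t => Real.cos (x * Real.sin t)) (π/2)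
    simp only [Real.sin_add_pi_div_two] at this
    rw [this]
    simp
  have i : ∀ a b : ℝ, IntervalIntegrable (fun s => Real.cos (x * Real.cos s)) volume a b := by
    intro a b; apply Continuous.intervalIntegrable; fun_prop
  have h3 : ∫ s in (-(π/2))..0, Real.cos (x * Real.cos s) = ∫ s in (0:ℝ)..(π/2), Real.cos (x * Real.cos s) := by
    have := intervalIntegral.integral_comp_neg (a := 0) (b := π/2) (fun s => Real.cos (x * Real.cos s))
    simp only [Real.cos_neg, neg_zero] at this
    exact this.symm
  rw [h2, ← intervalIntegral.integral_add_adjacent_intervals (i _ 0) (i 0 _), h3]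
  ring

lemma fG_asym : ∃ C : ℝ, 0 ≤ C ∧ ∀ x : ℝ, 0 < x → ‖(Real.sqrt x : ℂ) * fG x - Real.sqrt 2 * fF (Real.sqrt x)‖ ≤ C / Real.sqrt x := by
  have hπ := Real.pi_pos
  have c4 : ∀ t ∈ Set.Icc 0 (π/2), 0 < Real.cos (t/4) := by
    intro t ht; apply Real.cos_pos_of_mem_Ioo; constructor <;> linarith [ht.1, ht.2]
  have c2 : ∀ t ∈ Set.Icc 0 (π/2), 0 < Real.cos (t/2) := by
    intro t ht; apply Real.cos_pos_of_mem_Ioo; constructor <;> linarith [ht.1, ht.2]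
  have d4 : ∀ t : ℝ, HasDerivAt (fun t => t / 4) (1/4) t := fun t => (hasDerivAt_id t).div_const 4
  have d2 : ∀ t : ℝ, HasDerivAt (fun t => t / 2) (1/2) t := fun t => (hasDerivAt_id t).div_const 2
  obtain ⟨C, hC0, hC⟩ := ibp_osc (fun t => 1 - Real.cos t) (fun t => Real.sin t)
    (fun t => Real.sin (t/4) / (2 * (Real.cos (t/4) * Real.cos (t/2))))
    (fun t => (Real.cos (t/4) * (1/4) * (2 * (Real.cos (t/4) * Real.cos (t/2))) - Real.sin (t/4) * 
      (2 * (-Real.sin (t/4) * (1/4) * Real.cos (t/2) + Real.cos (t/4) * (-Real.sin (t/2) * (1/2)))))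
       / (2 * (Real.cos (t/4) * Real.cos (t/2)))^2) (π/2) (by positivity)
    (by intro t _; simpa using (Real.hasDerivAt_cos t).const_sub 1)
    (by
      intro t ht
      have := c4 t ht
      have := c2 t ht
      exact (d4 t).sin.div (((d4 t).cos.mul (d2 t).cos).const_mul 2) (by positivity))
    (by fun_prop)
    (by
      apply ContinuousOn.div (by fun_prop) (by fun_prop)
      intro t ht
      have := c4 t ht
      have := c2 t ht
      positivity)
  refine ⟨C, hC0, ?_⟩
  intro x hx
  have hs : 0 < Real.sqrt x := Real.sqrt_pos.2 hx
  have hs2 : Real.sqrt x ^ 2 = x := Real.sq_sqrt hx.le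
  have hs2c : (Real.sqrt x : ℂ)^2 = x := by exact_mod_cast hs2
  have hsub : ∫ t in (0:ℝ)..(π/2), Complex.exp (-(Complex.I * x * ((1 - Real.cos t : ℝ):ℂ))) * (Real.cos (t/2) : ℝ)
      = Real.sqrt 2 * ∫ v in (0:ℝ)..1, Complex.exp (-(Complex.I * (Real.sqrt x:ℂ)^2 * (v:ℂ)^2)) := by
    have h22 : Real.sqrt 2 ^ 2 = 2 := Real.sq_sqrt (by norm_num)
    have := intervalIntegral.integral_comp_smul_deriv (a := 0) (b := π/2)
      (f := fun t => Real.sqrt 2 * Real.sin (t/2)) (f' := fun t => Real.sqrt 2 * (Real.cos (t/2) * (1/2)))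
      (g := fun v : ℝ => Complex.exp (-(Complex.I * (Real.sqrt x:ℂ)^2 * (v:ℂ)^2)))
      (by intro t _; exact (d2 t).sin.const_mul _) (by fun_prop) (by fun_prop)
    have e1 : Real.sqrt 2 * Real.sin (π/2/2) = 1 := by
      rw [show π/2/2 = π/4 by ring, Real.sin_pi_div_four]; nlinarith
    simp only [zero_div, Real.sin_zero, mul_zero, e1] at this
    rw [← this, ← intervalIntegral.integral_const_mul]
    congr 1; ext t
    simp only [Function.comp, Complex.real_smul]
    rw [hs2c]
    have e2 : (1 - Real.cos t) = (Real.sqrt 2 * Real.sin (t/2))^2 := by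
      rw [mul_pow, h22, Real.sin_sq_eq_half_sub]; ring_nf
    rw [e2]
    have h22c : (Real.sqrt 2 : ℂ)^2 = 2 := by exact_mod_cast h22
    push_cast
    linear_combination (-(1/2) * Complex.exp (-(Complex.I * x * ((Real.sqrt 2:ℂ) * Complex.sin (t/2))^2)) * Complex.cos (t/2)) * h22c
  have i1 : IntervalIntegrable (fun t => Complex.exp (-(Complex.I * x * ((1 - Real.cos t : ℝ):ℂ))) * (Real.cos (t/2) : ℝ)) volume 0 (π/2) := by
    apply Continuous.intervalIntegrable; fun_prop
  have i0 : IntervalIntegrable (fun t => Complex.exp (-(Complex.I * x * ((1 - Real.cos t : ℝ):ℂ)))) volume 0 (π/2) := by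
    apply Continuous.intervalIntegrable; fun_prop
  have hdiff : fG x - ∫ t in (0:ℝ)..(π/2), Complex.exp (-(Complex.I * x * ((1 - Real.cos t : ℝ):ℂ))) * (Real.cos (t/2) : ℝ)
     = ∫ t in (0:ℝ)..(π/2), Complex.exp (-(Complex.I * x * ((1 - Real.cos t : ℝ):ℂ))) * 
        (Real.sin t * (Real.sin (t/4) / (2 * (Real.cos (t/4) * Real.cos (t/2)))) : ℝ) := by
    unfold fG
    rw [← intervalIntegral.integral_sub i0 i1]
    apply intervalIntegral.integral_congr
    intro t ht
    rw [Set.uIcc_of_le (by positivity)] at ht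
    have h4 := c4 t ht
    have h2 := c2 t ht
    have e : 1 - Real.cos (t/2) = Real.sin t * (Real.sin (t/4) / (2 * (Real.cos (t/4) * Real.cos (t/2)))) := by
      have s1 : Real.sin t = 2 * Real.sin (t/2) * Real.cos (t/2) := by
        rw [← Real.sin_two_mul]; ring_nf
      have s2 : Real.sin (t/2) = 2 * Real.sin (t/4) * Real.cos (t/4) := by
        rw [← Real.sin_two_mul]; ring_nf
      have s3 : Real.cos (t/2) = 1 - 2 * Real.sin (t/4)^2 := by
        rw [Real.sin_sq_eq_half_sub]; ring_nf
      rw [s1, s2]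
      field_simp
      linarith
    simp only
    rw [← e]; push_cast; ring
  have hle := hC x hx
  rw [← hdiff, hsub] at hle
  have hfin : (Real.sqrt x : ℂ) * fG x - Real.sqrt 2 * fF (Real.sqrt x) = Real.sqrt x * 
     (fG x - Real.sqrt 2 * ∫ v in (0:ℝ)..1, Complex.exp (-(Complex.I * (Real.sqrt x:ℂ)^2 * (v:ℂ)^2))) := by
    rw [← fF_scale]; ring
  rw [hfin, norm_mul, Complex.norm_real, Real.norm_eq_abs, abs_of_pos hs]
  have : C / Real.sqrt x = Real.sqrt x * (C / x) := by
    have h2 : C / x = C / Real.sqrt x ^ 2 := by rw [hs2]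
    rw [h2]
    field_simp
  rw [this]
  exact mul_le_mul_of_nonneg_left hle hs.le

lemma bj0_zeros (y : ℕ → ℝ) (hy : Filter.Tendsto y Filter.atTop Filter.atTop) (h0 : ∀ j, besselJ 0 (y j) = 0) :
    Filter.Tendsto (fun j => Real.sin (2 * y j)) Filter.atTop (nhds (-1)) := by
  obtain ⟨C, hC0, hC⟩ := fG_asym
  have hsq : Filter.Tendsto (fun j => Real.sqrt (y j)) Filter.atTop Filter.atTop := Real.tendsto_sqrt_atTop.comp hy
  -- w = e^{iy} F
  have hre : Filter.Tendsto (fun j => (Complex.exp (Complex.I * y j) * fF (Real.sqrt (y j))).re) Filter.atTop (nhds 0) := by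
    apply squeeze_zero_norm' (a := fun j => C / Real.sqrt (y j))
    · filter_upwards [hy.eventually_gt_atTop 0] with j hj
      have h1 := hC (y j) hj
      have h2 : (Complex.exp (Complex.I * y j) * fG (y j)).re = 0 := by
        have := h0 j
        rw [bj0_G] at this
        rcases mul_eq_zero.1 this with h | h
        · have : 0 < 2 / π := by positivity
          linarith
        · exact h
      have h3 : (Complex.exp (Complex.I * y j) * ((Real.sqrt (y j) : ℂ) * fG (y j) - Real.sqrt 2 * fF (Real.sqrt (y j)))).re
         = - (Real.sqrt 2 * (Complex.exp (Complex.I * y j) * fF (Real.sqrt (y j))).re) := by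
        have : Complex.exp (Complex.I * y j) * ((Real.sqrt (y j) : ℂ) * fG (y j) - Real.sqrt 2 * fF (Real.sqrt (y j)))
          = (Real.sqrt (y j) : ℂ) * (Complex.exp (Complex.I * y j) * fG (y j)) - 
            (Real.sqrt 2 : ℂ) * (Complex.exp (Complex.I * y j) * fF (Real.sqrt (y j))) := by ring
        rw [this, Complex.sub_re, Complex.re_ofReal_mul, Complex.re_ofReal_mul, h2]; ring
      have h4 := Complex.abs_re_le_norm (Complex.exp (Complex.I * y j) * ((Real.sqrt (y j) : ℂ) * fG (y j) - Real.sqrt 2 * fF (Real.sqrt (y j))))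
      have h5 : ‖Complex.exp (Complex.I * y j)‖ = 1 := by rw [mul_comm, Complex.norm_exp_ofReal_mul_I]
      rw [norm_mul, h5, one_mul, h3, abs_neg, abs_mul, abs_of_pos (by positivity : 0 < Real.sqrt 2)] at h4
      have h6 : 1 ≤ Real.sqrt 2 := Real.one_le_sqrt.2 (by norm_num)
      rw [Real.norm_eq_abs]
      have h7 := abs_nonneg (Complex.exp (Complex.I * y j) * fF (Real.sqrt (y j))).re
      nlinarith
    · exact Filter.Tendsto.div_atTop tendsto_const_nhds hsq
  have hF2 := fF_sq_tendsto.comp hsq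
  have hnorm := hF2.norm
  have hval : ‖-(Complex.I * ((π:ℂ)/4))‖ = π / 4 := by
    rw [norm_neg, norm_mul, Complex.norm_I, one_mul, show (π / 4 : ℂ) = ((π/4 : ℝ) : ℂ) by push_cast; rfl,
      Complex.norm_real, Real.norm_eq_abs, abs_of_pos (by positivity)]
  rw [hval] at hnorm
  -- e^{2iy}(F^2 + iπ/4) → 0
  have hdiff : Filter.Tendsto (fun j => (Complex.exp (Complex.I * y j) ^ 2 * (fF (Real.sqrt (y j)) ^ 2 + Complex.I * (π/4))).re) Filter.atTop (nhds 0) := by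
    have h1 : Filter.Tendsto (fun j => ‖fF (Real.sqrt (y j)) ^ 2 + Complex.I * (π/4)‖) Filter.atTop (nhds 0) := by
      have := (hF2.add_const (Complex.I * (π/4))).norm
      simpa using this
    apply squeeze_zero_norm' _ h1
    refine Filter.Eventually.of_forall fun j => ?_
    rw [Real.norm_eq_abs]
    refine (Complex.abs_re_le_norm _).trans ?_
    have h5 : ‖Complex.exp (Complex.I * y j)‖ = 1 := by rw [mul_comm, Complex.norm_exp_ofReal_mul_I]
    rw [norm_mul, norm_pow, h5]; simp
  have hid : ∀ j, Real.sin (2 * y j) = (4/π) * (2 * (Complex.exp (Complex.I * y j) * fF (Real.sqrt (y j))).re ^2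
      - ‖fF (Real.sqrt (y j)) ^ 2‖ - (Complex.exp (Complex.I * y j) ^ 2 * (fF (Real.sqrt (y j)) ^ 2 + Complex.I * (π/4))).re) := by
    intro j
    set F := fF (Real.sqrt (y j))
    have e1 : Complex.exp (Complex.I * y j) = ⟨Real.cos (y j), Real.sin (y j)⟩ := by
      apply Complex.ext
      · rw [mul_comm, Complex.exp_ofReal_mul_I_re]
      · rw [mul_comm, Complex.exp_ofReal_mul_I_im]
    have e2 : ‖F^2‖ = F.re^2 + F.im^2 := by
      rw [norm_pow, ← Complex.normSq_eq_norm_sq, Complex.normSq_apply]; ring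
    have e3 : (Complex.I * ((π:ℂ)/4)) = ⟨0, π/4⟩ := by
      apply Complex.ext <;> simp
    rw [e1, e2, e3, Real.sin_two_mul]
    simp only [pow_two, Complex.mul_re, Complex.mul_im, Complex.add_re, Complex.add_im]
    have hc := Real.sin_sq_add_cos_sq (y j)
    have hπ := Real.pi_pos
    field_simp
    linear_combination (-4 * (F.re^2 + F.im^2)) * hc
  have hlim : Filter.Tendsto (fun j => (4/π) * (2 * (Complex.exp (Complex.I * y j) * fF (Real.sqrt (y j))).re ^2
      - ‖fF (Real.sqrt (y j)) ^ 2‖ - (Complex.exp (Complex.I * y j) ^ 2 * (fF (Real.sqrt (y j)) ^ 2 + Complex.I * (π/4))).re))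
      Filter.atTop (nhds ((4/π) * (2 * 0^2 - π/4 - 0))) :=
    (((hre.pow 2).const_mul 2).sub hnorm |>.sub hdiff).const_mul _
  have hv : (4/π) * (2 * 0^2 - π/4 - 0) = -1 := by field_simp; ring
  rw [hv] at hlim
  exact hlim.congr fun j => (hid j).symm


noncomputable def TT (n : ℕ) (x : ℝ) : ℝ := pp n x - n * Real.arccos (n / x)

lemma TT_d {n : ℕ} {x : ℝ} (hx : (n:ℝ) < x) : HasDerivAt (TT n) (pp n x / x) x := by
  have hn : (0:ℝ) ≤ n := Nat.cast_nonneg n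
  have hx0 : 0 < x := lt_of_le_of_lt hn hx
  have hp := pp_pos hx
  have hy1 : (n:ℝ) / x < 1 := by rw [div_lt_one hx0]; exact hx
  have hy0 : 0 ≤ (n:ℝ) / x := by positivity
  have h1 : HasDerivAt (fun t : ℝ => (n:ℝ) / t) (-(n:ℝ) / x^2) x := by
    have := (hasDerivAt_inv hx0.ne').const_mul (n:ℝ)
    simp only [← div_eq_mul_inv] at this
    refine this.congr_deriv ?_
    field_simp
  have h2 := (Real.hasDerivAt_arccos (x := (n:ℝ)/x) (by linarith) (by linarith)).comp x h1
  have hs : Real.sqrt (1 - ((n:ℝ)/x)^2) = pp n x / x := by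
    have : 1 - ((n:ℝ)/x)^2 = (pp n x / x)^2 := by
      rw [div_pow, div_pow, pp_sq hx]; field_simp
    rw [this, Real.sqrt_sq (by positivity)]
  have h3 := (pp_d hx).sub (h2.const_mul (n:ℝ))
  refine h3.congr_deriv ?_
  rw [hs]
  have := pp_sq hx
  field_simp
  linarith

lemma le_diff_of_deriv {f f' : ℝ → ℝ} {M a b : ℝ} (ha : 0 < a) (hab : a ≤ b) (hM : 0 ≤ M)
    (hd : ∀ x, a ≤ x → HasDerivAt f (f' x) x) (hb : ∀ x, a ≤ x → |f' x| ≤ M / x^2) :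
    |f b - f a| ≤ M / a := by
  have hinv : ∀ x, a ≤ x → HasDerivAt (fun t : ℝ => M / t) (-M / x^2) x := by
    intro x hx
    have hx0 := ha.trans_le hx
    have := (hasDerivAt_inv hx0.ne').const_mul M
    simp only [← div_eq_mul_inv] at this
    refine this.congr_deriv ?_
    field_simp
  have hMb : 0 ≤ M / b := div_nonneg hM (ha.le.trans hab)
  have m1 : MonotoneOn (fun t => f t - M / t) (Set.Ici a) := by
    apply monotoneOn_of_deriv_nonneg (convex_Ici a)
    · intro x hx; exact ((hd x hx).sub (hinv x hx)).continuousAt.continuousWithinAt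
    · intro x hx; rw [interior_Ici] at hx
      exact ((hd x (le_of_lt hx)).sub (hinv x (le_of_lt hx))).differentiableAt.differentiableWithinAt
    · intro x hx; rw [interior_Ici] at hx
      have := ((hd x (le_of_lt hx)).sub (hinv x (le_of_lt hx))).deriv
      have h2 := (abs_le.1 (hb x (le_of_lt hx))).1
      have h3 : deriv (fun t => f t - M / t) x = f' x - -M / x^2 := this
      rw [h3, neg_div]; linarith
  have m2 : AntitoneOn (fun t => f t + M / t) (Set.Ici a) := by
    apply antitoneOn_of_deriv_nonpos (convex_Ici a)
    · intro x hx; exact ((hd x hx).add (hinv x hx)).continuousAt.continuousWithinAt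
    · intro x hx; rw [interior_Ici] at hx
      exact ((hd x (le_of_lt hx)).add (hinv x (le_of_lt hx))).differentiableAt.differentiableWithinAt
    · intro x hx; rw [interior_Ici] at hx
      have := ((hd x (le_of_lt hx)).add (hinv x (le_of_lt hx))).deriv
      have h2 := (abs_le.1 (hb x (le_of_lt hx))).2
      have h3 : deriv (fun t => f t + M / t) x = f' x + -M / x^2 := this
      rw [h3, neg_div]; linarith
  have a1 := m1 (Set.mem_Ici.2 le_rfl) (Set.mem_Ici.2 hab) hab
  have a2 := m2 (Set.mem_Ici.2 le_rfl) (Set.mem_Ici.2 hab) hab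
  simp only at a1 a2
  rw [abs_le]; constructor <;> linarith

structure Ph (σ : ℝ) (η χ θ : ℕ → ℝ → ℝ) : Prop where
  e : ∀ n, IsLift 0 (cP n) (cP' n) (η n)
  e1 : ∀ n, |η n 1| < π / 2
  ee : ∀ n x, 0 < x → |η (n+1) x - (η n x - π / 2)| < π
  c : ∀ n, IsLift 0 (cS σ n) (cS' σ n) (χ n)
  ce : ∀ n x, 0 < x → |χ n x - η n x| < π
  t : ∀ n : ℕ, IsLift n (cQ n) (cQ' n) (θ n)
  tc : ∀ (n : ℕ) x, (n:ℝ) < x → |θ n x - χ n x| < π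

lemma Ph_exists (σ : ℝ) : ∃ η χ θ, Ph σ η χ θ := by
  obtain ⟨η, h1, h2⟩ := cP_seq
  choose χ hχ using fun n => chi_exists σ n (h1 n).1
  choose θ hθ using fun n => theta_exists σ n (hχ n).1
  exact ⟨η, χ, θ, fun n => (h1 n).1, fun n => (h1 n).2, h2, fun n => (hχ n).1, fun n => (hχ n).2,
    fun n => (hθ n).1, fun n => (hθ n).2⟩

lemma Ph.osc {σ : ℝ} {η χ θ : ℕ → ℝ → ℝ} (h : Ph σ η χ θ) {K : ℝ} (hK : 1 ≤ K) (n : ℕ) {x y : ℝ}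
    (hx : (n:ℝ) < x) (hk : x^2 ≤ K^2 * (x^2 - n^2)) (hxy : x ≤ y) :
    |(θ n y - TT n y) - (θ n x - TT n x)| ≤ 3 * K^6 / x := by
  have hn : (0:ℝ) ≤ n := Nat.cast_nonneg n
  have hx0 : 0 < x := lt_of_le_of_lt hn hx
  have hK0 : 0 < K := by linarith
  apply le_diff_of_deriv (f := fun x => θ n x - TT n x) 
    (f' := fun x => (cQ' n x / cQ n x).im - pp n x / x) hx0 hxy (by positivity)
  · intro t ht
    exact (h.t n t (by linarith)).2.2.1.sub (TT_d (by linarith))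
  · intro t ht
    have htn : (n:ℝ) < t := by linarith
    have ht0 : 0 < t := by linarith
    have hp := pp_pos htn
    have hp2 := pp_sq htn
    refine (theta_deriv n htn).trans ?_
    have hkt : t^2 ≤ K^2 * pp n t ^2 := by
      rw [hp2]
      have : x^2 ≤ t^2 := by nlinarith
      have hK2 : 0 ≤ K^2 - 1 := by nlinarith
      nlinarith
    have hkt1 : t ≤ K * pp n t := by
      apply le_of_sq_le_sq _ (by positivity)
      nlinarith
    have hpt : pp n t ≤ t := by
      apply le_of_sq_le_sq _ ht0.le
      rw [hp2]; nlinarith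
    have hpt1 : pp n t / t ≤ 1 := by rw [div_le_one ht0]; exact hpt
    have b1 : 5/4 * t^4 / pp n t ^ 6 ≤ 5/4 * K^6 / t^2 := by
      rw [div_le_div_iff₀ (by positivity) (by positivity)]
      have : t^6 ≤ (K * pp n t)^6 := by gcongr
      nlinarith
    have b2 : t^2 / pp n t ^ 4 ≤ K^4 / t^2 := by
      rw [div_le_div_iff₀ (by positivity) (by positivity)]
      have : t^4 ≤ (K * pp n t)^4 := by gcongr
      nlinarith
    have b3 : K^4 / t^2 ≤ K^6 / t^2 := by gcongr; norm_num
    have b0 : 0 ≤ 5/4 * t^4 / pp n t ^ 6 := by positivity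
    have b0' : 0 ≤ t^2 / pp n t ^ 4 := by positivity
    have b4 : |5/4 * t^4 / pp n t ^ 6 - t^2 / pp n t ^ 4| ≤ 3 * K^6 / t^2 := by
      have e1 : 5/4 * K^6 / t^2 = 5/4 * (K^6 / t^2) := by ring
      have e2 : 3 * K^6 / t^2 = 3 * (K^6 / t^2) := by ring
      have e3 : 0 ≤ K^6 / t^2 := by positivity
      rw [abs_le]; constructor <;> linarith
    calc _ ≤ 1 * (3 * K^6 / t^2) := by
          apply mul_le_mul hpt1 b4 (abs_nonneg _) (by norm_num)
      _ = _ := one_mul _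

lemma two_ok {n : ℕ} {x : ℝ} (hx : 2 * (n:ℝ) + 1 ≤ x) : (n:ℝ) < x ∧ x^2 ≤ 2^2 * (x^2 - n^2) := by
  have hn : (0:ℝ) ≤ n := Nat.cast_nonneg n
  constructor
  · linarith
  · nlinarith

lemma Ph.lim {σ : ℝ} {η χ θ : ℕ → ℝ → ℝ} (h : Ph σ η χ θ) (n : ℕ) :
    ∃ c, Filter.Tendsto (fun x => θ n x - TT n x) Filter.atTop (nhds c) := by
  apply cauchySeq_tendsto_of_complete
  rw [Metric.cauchySeq_iff']
  intro ε hε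
  refine ⟨max (2 * (n:ℝ) + 1) (200 / ε), fun y hy => ?_⟩
  have hm : 2 * (n:ℝ) + 1 ≤ max (2 * (n:ℝ) + 1) (200 / ε) := le_max_left _ _
  have hm2 : 200 / ε ≤ max (2 * (n:ℝ) + 1) (200 / ε) := le_max_right _ _
  have hn : (0:ℝ) ≤ n := Nat.cast_nonneg n
  have h1 := h.osc (K := 2) (by norm_num) n (two_ok hm).1 (two_ok hm).2 hy
  rw [Real.dist_eq]
  refine h1.trans_lt ?_
  rw [div_lt_iff₀ (by linarith)]
  rw [div_le_iff₀ hε] at hm2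
  nlinarith

lemma Ph.lim_bound {σ : ℝ} {η χ θ : ℕ → ℝ → ℝ} (h : Ph σ η χ θ) {K : ℝ} (hK : 1 ≤ K) (n : ℕ) {x c : ℝ}
    (hx : (n:ℝ) < x) (hk : x^2 ≤ K^2 * (x^2 - n^2))
    (hc : Filter.Tendsto (fun x => θ n x - TT n x) Filter.atTop (nhds c)) :
    |c - (θ n x - TT n x)| ≤ 3 * K^6 / x := by
  have h1 := (hc.sub_const (θ n x - TT n x)).abs
  apply le_of_tendsto h1
  filter_upwards [Filter.eventually_ge_atTop x] with y hy
  exact h.osc hK n hx hk hy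

lemma TT_ge {n : ℕ} {x : ℝ} (hx : (n:ℝ) < x) : x - n - n * π ≤ TT n x := by
  have hn : (0:ℝ) ≤ n := Nat.cast_nonneg n
  unfold TT
  have h1 : x - n ≤ pp n x := by
    apply le_of_sq_le_sq _ (pp_pos hx).le
    rw [pp_sq hx]; nlinarith
  have h2 := mul_le_mul_of_nonneg_left (Real.arccos_le_pi ((n:ℝ)/x)) hn
  linarith

lemma Ph.tend {σ : ℝ} {η χ θ : ℕ → ℝ → ℝ} (h : Ph σ η χ θ) (n : ℕ) :
    Filter.Tendsto (θ n) Filter.atTop Filter.atTop := by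
  obtain ⟨c, hc⟩ := h.lim n
  have hT : Filter.Tendsto (TT n) Filter.atTop Filter.atTop := by
    have : Filter.Tendsto (fun x : ℝ => x + (-n - n * π)) Filter.atTop Filter.atTop :=
      Filter.tendsto_atTop_add_const_right _ _ Filter.tendsto_id
    apply Filter.tendsto_atTop_mono' _ _ this
    filter_upwards [Filter.eventually_gt_atTop (n:ℝ)] with x hx
    have := TT_ge hx
    linarith
  have := hc.add_atTop hT
  refine this.congr fun x => by ring

lemma Ph.zeros {σ : ℝ} {η χ θ : ℕ → ℝ → ℝ} (h : Ph σ η χ θ) (n : ℕ) :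
    ∃ y : ℕ → ℝ, Filter.Tendsto y Filter.atTop Filter.atTop ∧ ∀ j, (n:ℝ) < y j ∧ 1 ≤ y j ∧
      ∃ i : ℤ, θ n (y j) = i * π + π / 2 := by
  have key : ∀ X : ℕ, ∃ y : ℝ, (X:ℝ) ≤ y ∧ (n:ℝ) < y ∧ 1 ≤ y ∧ ∃ i : ℤ, θ n y = i * π + π / 2 := by
    intro X
    have hn : (0:ℝ) ≤ n := Nat.cast_nonneg n
    have hX : (0:ℝ) ≤ X := Nat.cast_nonneg X
    have hπ := Real.pi_pos
    set X' : ℝ := X + n + 1 with hX'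
    obtain ⟨i, hi⟩ := exists_int_gt (θ n X' / π)
    rw [div_lt_iff₀ hπ] at hi
    obtain ⟨Y, hY1, hY2⟩ := ((h.tend n).eventually_ge_atTop (i * π + π/2) |>.and
      (Filter.eventually_ge_atTop X')).exists
    have hcont : ContinuousOn (θ n) (Set.Icc X' Y) := fun t ht =>
      ((h.t n).cont (by have := ht.1; linarith)).continuousWithinAt
    obtain ⟨y, hy, hye⟩ := intermediate_value_Icc hY2 hcont
      (show i * π + π/2 ∈ Set.Icc (θ n X') (θ n Y) from ⟨by linarith, hY1⟩)
    have := hy.1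
    exact ⟨y, by linarith, by linarith, by linarith, i, hye⟩
  choose y hy using key
  exact ⟨y, Filter.tendsto_atTop_mono (fun j => (hy j).1) tendsto_natCast_atTop_atTop, fun j => (hy j).2⟩


lemma pp_sub (n : ℕ) : Filter.Tendsto (fun x : ℝ => pp n x - x) Filter.atTop (nhds 0) := by
  have h1 : Filter.Tendsto (fun x : ℝ => (n:ℝ)^2 / x) Filter.atTop (nhds 0) :=
    Filter.Tendsto.div_atTop tendsto_const_nhds Filter.tendsto_id
  apply squeeze_zero_norm' _ h1
  filter_upwards [Filter.eventually_gt_atTop (n:ℝ)] with x hx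
  have hn : (0:ℝ) ≤ n := Nat.cast_nonneg n
  have hx0 : 0 < x := lt_of_le_of_lt hn hx
  have hp := pp_pos hx
  have hp2 := pp_sq hx
  rw [Real.norm_eq_abs, le_div_iff₀ hx0]
  have hpt : pp n x ≤ x := by
    apply le_of_sq_le_sq _ hx0.le
    rw [hp2]; nlinarith
  rw [abs_of_nonpos (by linarith)]
  nlinarith

lemma pp_div (n : ℕ) : Filter.Tendsto (fun x : ℝ => pp n x / x) Filter.atTop (nhds 1) := by
  have h1 : Filter.Tendsto (fun x : ℝ => (pp n x - x) / x + 1) Filter.atTop (nhds (0 + 1)) :=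
    ((pp_sub n).div_atTop Filter.tendsto_id).add_const 1
  rw [zero_add] at h1
  refine h1.congr' ?_
  filter_upwards [Filter.eventually_gt_atTop (0:ℝ)] with x hx
  field_simp; ring

lemma TT_lim (n : ℕ) : Filter.Tendsto (fun x : ℝ => TT n x - x) Filter.atTop (nhds (-(n * (π/2)))) := by
  have h1 : Filter.Tendsto (fun x : ℝ => (n:ℝ) / x) Filter.atTop (nhds 0) :=
    Filter.Tendsto.div_atTop tendsto_const_nhds Filter.tendsto_id
  have h2 := ((Real.continuous_arccos.tendsto 0).comp h1).const_mul (n:ℝ)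
  have h3 := (pp_sub n).sub h2
  rw [Real.arccos_zero, zero_sub] at h3
  refine h3.congr fun x => ?_
  simp only [TT, Function.comp]; ring

lemma eps_lim (n : ℕ) : Filter.Tendsto (fun x : ℝ => n / pp n x + x^2 / (2 * pp n x ^ 3)) Filter.atTop (nhds 0) := by
  have h1 : Filter.Tendsto (fun x : ℝ => (n:ℝ) / x) Filter.atTop (nhds 0) :=
    Filter.Tendsto.div_atTop tendsto_const_nhds Filter.tendsto_id
  have h2 : Filter.Tendsto (fun x : ℝ => (1:ℝ) / x) Filter.atTop (nhds 0) :=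
    Filter.Tendsto.div_atTop tendsto_const_nhds Filter.tendsto_id
  have h3 := (h1.div (pp_div n) (by norm_num)).add (h2.div (((pp_div n).pow 3).const_mul 2) (by norm_num))
  norm_num at h3
  refine h3.congr' ?_
  filter_upwards [Filter.eventually_gt_atTop (n:ℝ)] with x hx
  have hn : (0:ℝ) ≤ n := Nat.cast_nonneg n
  have hx0 : 0 < x := lt_of_le_of_lt hn hx
  have hp := pp_pos hx

  field_simp

lemma cos_hpi (i : ℤ) : Real.cos (i * π + π / 2) = 0 := by
  rw [Real.cos_add_pi_div_two, Real.sin_int_mul_pi, neg_zero]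

lemma Ph.jzero {σ : ℝ} {η χ θ : ℕ → ℝ → ℝ} (h : Ph σ η χ θ) (n : ℕ) {y : ℝ} (hy : (n:ℝ) < y) (i : ℤ)
    (ht : θ n y = i * π + π / 2) : besselJ n y = 0 := by
  have := (h.t n).re hy
  rw [ht, cos_hpi, mul_zero] at this
  simpa [cQ, cur_re] using this

lemma Ph.c_zero {σ : ℝ} {η χ θ : ℕ → ℝ → ℝ} (h : Ph σ η χ θ) :
    Filter.Tendsto (fun x => θ 0 x - TT 0 x) Filter.atTop (nhds (-(π/4))) := by
  obtain ⟨c, hc⟩ := h.lim 0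
  have hπ := Real.pi_gt_three
  have hπ4 : π < 3.15 := Real.pi_lt_d2
  obtain ⟨y, hy, hy2⟩ := h.zeros 0
  have hp0 : ∀ x : ℝ, 0 < x → pp 0 x = x := by
    intro x hx; unfold pp; norm_num; exact Real.sqrt_sq hx.le
  have hT0 : ∀ x : ℝ, 0 < x → TT 0 x = x := by
    intro x hx; unfold TT; rw [hp0 x hx]; norm_num
  have hz : ∀ j, besselJ 0 (y j) = 0 := by
    intro j
    obtain ⟨a, b, i, hi⟩ := hy2 j
    exact h.jzero 0 a i hi
  have h1 := bj0_zeros y hy hz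
  have h2 : Filter.Tendsto (fun j => Real.sin (2 * (θ 0 (y j) - TT 0 (y j)))) Filter.atTop (nhds (Real.sin (2 * c))) :=
    (Real.continuous_sin.tendsto _).comp ((hc.comp hy).const_mul 2)
  have h3 : ∀ j, Real.sin (2 * (θ 0 (y j) - TT 0 (y j))) = Real.sin (2 * y j) := by
    intro j
    obtain ⟨a, b, i, hi⟩ := hy2 j
    rw [hT0 _ (by linarith), hi]
    have : 2 * (i * π + π / 2 - y j) = (π - 2 * y j) + i * (2 * π) := by ring
    rw [this, Real.sin_add_int_mul_two_pi, Real.sin_pi_sub]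
  simp only [h3] at h2
  have hs : Real.sin (2 * c) = -1 := tendsto_nhds_unique h2 h1
  -- bound
  have hb : ∀ y : ℝ, 1 ≤ y → |(θ 0 y - TT 0 y) - (θ 0 1 - TT 0 1)| ≤ (1/4) / 1 := by
    intro y hy
    apply le_diff_of_deriv (f := fun x => θ 0 x - TT 0 x) 
      (f' := fun x => (cQ' 0 x / cQ 0 x).im - pp 0 x / x) one_pos hy (by norm_num)
    · intro t ht
      have : ((0:ℕ):ℝ) < t := by push_cast; linarith
      exact (h.t 0 t this).2.2.1.sub (TT_d this)
    · intro t ht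
      have h0 : ((0:ℕ):ℝ) < t := by push_cast; linarith
      have ht0 : 0 < t := by linarith
      refine (theta_deriv 0 h0).trans ?_
      rw [hp0 t ht0]
      have e : 5/4 * t^4 / t^6 - t^2/t^4 = 1/4/t^2 := by field_simp; norm_num
      rw [e, abs_of_pos (by positivity), div_self ht0.ne', one_mul]
  have hcb : |c - (θ 0 1 - TT 0 1)| ≤ 1/4 := by
    apply le_of_tendsto (hc.sub_const (θ 0 1 - TT 0 1)).abs
    filter_upwards [Filter.eventually_ge_atTop (1:ℝ)] with y hy
    simpa using hb y hy
  have hth : |θ 0 1| < π/2 := by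
    have o : ((0:ℕ):ℝ) < 1 := by norm_num
    have e1 := (h.e 0).re one_pos
    have e2 := (h.c 0).re one_pos
    have e3 := (h.t 0).re o
    simp only [cP, cS, cQ, cur_re] at e1 e2 e3
    have a1 := cell_i ((h.e 0).pos one_pos) ((h.c 0).pos one_pos) e1 e2 (h.ce 0 1 one_pos) 0
      (by simpa using h.e1 0)
    have a2 := cell_i ((h.c 0).pos one_pos) ((h.t 0).pos o) e2 e3 (h.tc 0 1 o) 0 a1
    simpa using a2
  rw [hT0 1 one_pos] at hcb
  rw [abs_le] at hcb
  rw [abs_lt] at hth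
  have hcos : Real.cos (2 * c + π / 2) = 1 := by rw [Real.cos_add_pi_div_two, hs]; norm_num
  have := (Real.cos_eq_one_iff_of_lt_of_lt (by linarith [hcb.1, hth.1]) (by linarith [hcb.2, hth.2])).1 hcos
  have hce : c = -(π/4) := by linarith
  rwa [hce] at hc

lemma Ph.step_pt {σ : ℝ} {η χ θ : ℕ → ℝ → ℝ} (h : Ph σ η χ θ) (n : ℕ) {y : ℝ} (hy : ((n+1:ℕ):ℝ) < y) (i : ℤ)
    (ht : θ (n+1) y = i * π + π / 2) :
    θ (n+1) y - θ n y + π/2 = Real.arctan (n / pp n y + y^2 / (2 * pp n y ^ 3)) := by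
  have hJ := h.jzero (n+1) hy i ht
  have hπ := Real.pi_pos
  have hyn : (n:ℝ) < y := by push_cast at hy; linarith
  have hn : (0:ℝ) ≤ n := Nat.cast_nonneg n
  have hy0 : 0 < y := by linarith
  have e1 := (h.e (n+1)).re hy0
  have e2 := (h.c (n+1)).re hy0
  have e3 := (h.t (n+1)).re hy
  simp only [cP, cS, cQ, cur_re, hJ] at e1 e2 e3
  have a1 := cell_ii ((h.e (n+1)).pos hy0) ((h.c (n+1)).pos hy0) e1 e2 (h.ce (n+1) y hy0)
  have a2 := cell_ii ((h.c (n+1)).pos hy0) ((h.t (n+1)).pos hy) e2 e3 (h.tc (n+1) y hy)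
  have e4 := (h.e n).im hy0
  simp only [cP, cur_im, hJ] at e4
  have a3 := cell_ii (θ1 := η n y - π/2) ((h.e n).pos hy0) ((h.e (n+1)).pos hy0)
    (by rw [Real.cos_sub_pi_div_two]; exact e4) e1 (h.ee n y hy0)
  have hη : η n y = ((i+1:ℤ):ℝ) * π := by push_cast; linarith
  have f1 := (h.e n).re hy0
  have f2 := (h.c n).re hy0
  have f3 := (h.t n).re hyn
  have f4 := (h.t n).im hyn
  simp only [cP, cS, cQ, cur_re, cur_im] at f1 f2 f3 f4
  have b1 := cell_i ((h.e n).pos hy0) ((h.c n).pos hy0) f1 f2 (h.ce n y hy0) (i+1) (by rw [hη]; simp; positivity)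
  have b2 := cell_i ((h.c n).pos hy0) ((h.t n).pos hyn) f2 f3 (h.tc n y hyn) (i+1) b1
  have hp := pp_pos hyn
  have hr := (h.t n).pos hyn
  set r := ‖cQ n y‖
  have hr : 0 < r := hr
  set ε := n / pp n y + y^2 / (2 * pp n y ^ 3) with hε
  have hsc : Real.sin (θ n y) = -ε * Real.cos (θ n y) := by
    have : r * Real.sin (θ n y) = r * (-ε * Real.cos (θ n y)) := by
      change _ = r * Real.sin (θ n y) at f4
      change _ = r * Real.cos (θ n y) at f3
      rw [← f4, mul_left_comm, ← f3]
      unfold bK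
      rw [hJ, hε]; ring
    exact mul_left_cancel₀ hr.ne' this
  set u := θ n y - ((i+1:ℤ):ℝ) * π with hu
  have hsu : Real.sin u = -ε * Real.cos u := by
    rw [hu, Real.sin_sub, Real.cos_sub, Real.sin_int_mul_pi, hsc]; ring
  rw [abs_lt] at b2
  have hcu : 0 < Real.cos u := Real.cos_pos_of_mem_Ioo ⟨b2.1, b2.2⟩
  have htan : Real.tan u = -ε := by
    rw [Real.tan_eq_sin_div_cos, hsu]; field_simp
  have : u = -Real.arctan ε := by
    rw [← Real.arctan_neg, ← htan, Real.arctan_tan b2.1 b2.2]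
  push_cast at hu
  linarith

lemma Ph.c_all {σ : ℝ} {η χ θ : ℕ → ℝ → ℝ} (h : Ph σ η χ θ) (n : ℕ) :
    Filter.Tendsto (fun x => θ n x - TT n x) Filter.atTop (nhds (-(π/4))) := by
  induction n with
  | zero => exact h.c_zero
  | succ n ih =>
    obtain ⟨c, hc⟩ := h.lim (n+1)
    obtain ⟨y, hy, hy2⟩ := h.zeros (n+1)
    have h1 : Filter.Tendsto (fun j => Real.arctan (n / pp n (y j) + (y j)^2 / (2 * pp n (y j) ^ 3)))
      Filter.atTop (nhds (Real.arctan 0)) :=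
      (Real.continuous_arctan.tendsto 0).comp ((eps_lim n).comp hy)
    rw [Real.arctan_zero] at h1
    have h2 : Filter.Tendsto (fun j => θ (n+1) (y j) - θ n (y j) + π/2) Filter.atTop (nhds 0) := by
      refine h1.congr fun j => ?_
      obtain ⟨a, b, i, hi⟩ := hy2 j
      exact (h.step_pt n a i hi).symm
    have h3 := (((hc.sub ih).add ((TT_lim (n+1)).sub (TT_lim n))).add_const (π/2)).comp hy
    have h4 := tendsto_nhds_unique (h2.congr fun j => by simp only [Function.comp]; ring) h3
    have : c = -(π/4) := by push_cast at h4; linarith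
    rwa [this] at hc

lemma Ph.main {σ : ℝ} {η χ θ : ℕ → ℝ → ℝ} (h : Ph σ η χ θ) {K : ℝ} (hK : 1 ≤ K) (n : ℕ) {x : ℝ}
    (hx : (n:ℝ) < x) (hk : x^2 ≤ K^2 * (x^2 - n^2)) :
    |θ n x - (TT n x - π/4)| ≤ 3 * K^6 / x := by
  have := h.lim_bound hK n hx hk (h.c_all n)
  rw [abs_sub_comm] at this
  convert this using 2
  ring


lemma Ph.phi_iff {σ : ℝ} {η χ θ : ℕ → ℝ → ℝ} (h : Ph σ η χ θ) (n : ℕ) {t : ℝ} (ht : 0 < t) :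
    phiRobin σ n t = 0 ↔ Real.sin (χ n t) = 0 := by
  have h1 := (h.c n).im ht
  have hr := (h.c n).pos ht
  simp only [cS, cur_im] at h1
  rw [← phi_eq] at h1
  constructor
  · intro h0
    rw [h0, neg_zero] at h1
    rcases mul_eq_zero.1 h1.symm with h2 | h2
    · exact absurd h2 hr.ne'
    · exact h2
  · intro h0
    rw [h0, mul_zero] at h1
    linarith

lemma Ph.count_aux {σ : ℝ} {η χ θ : ℕ → ℝ → ℝ} (h : Ph σ η χ θ) (n : ℕ) {a x : ℝ} (ha : 0 < a)
    (hna : (n:ℝ) ≤ a) (hax : a ≤ x) (hJ : ∀ t, 0 < t → t ≤ max 1 a → 0 < besselJ n t)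
    (hφ : ∀ t, 0 < t → t ≤ a → 0 < phiRobin σ n t) :
    ({t : ℝ | t ∈ Set.Ioc 0 x ∧ phiRobin σ n t = 0}).Finite ∧
    ∀ k : ℤ, 1 ≤ k → (k ≤ (({t : ℝ | t ∈ Set.Ioc 0 x ∧ phiRobin σ n t = 0}).ncard : ℤ) ↔
      (k - 1) * π ≤ χ n x) := by
  have hπ := Real.pi_pos
  have hcell : |η n a| < π/2 := by
    apply stay_cell (a := 1) (b := a)
    · intro t ht
      have : 0 < t := lt_of_lt_of_le (lt_min one_pos ha) ht.1
      exact ((h.e n).cont this).continuousWithinAt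
    · intro t ht hc
      have h0 : 0 < t := lt_of_lt_of_le (lt_min one_pos ha) ht.1
      have h1 := (h.e n).re h0
      rw [hc, mul_zero] at h1
      simp only [cP, cur_re] at h1
      exact (hJ t h0 ht.2).ne' h1
    · exact h.e1 n
  have f1 := (h.e n).re ha
  have f2 := (h.c n).re ha
  have f3 := (h.c n).im ha
  have hr := (h.c n).pos ha
  simp only [cP, cS, cur_re, cur_im] at f1 f2 f3
  have b1 := cell_i ((h.e n).pos ha) ((h.c n).pos ha) f1 f2 (h.ce n a ha) 0 (by simpa using hcell)
  simp only [Int.cast_zero, zero_mul, sub_zero] at b1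
  rw [abs_lt] at b1
  rw [← phi_eq] at f3
  have hs : Real.sin (χ n a) < 0 := by
    have := hφ a ha le_rfl
    by_contra hcon
    push Not at hcon
    have := mul_nonneg hr.le hcon
    simp only [cS] at this
    linarith
  have hneg : χ n a < 0 := by
    by_contra hcon
    push Not at hcon
    have := Real.sin_nonneg_of_nonneg_of_le_pi hcon (by linarith)
    linarith
  have hcont : ContinuousOn (χ n) (Set.Ici a) := fun t ht =>
    ((h.c n).cont (lt_of_lt_of_le ha ht)).continuousWithinAt
  have hmono : StrictMonoOn (χ n) (Set.Ici a) := by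
    apply strictMonoOn_of_deriv_pos (convex_Ici a) hcont
    intro t ht
    rw [interior_Ici] at ht
    have ht : a < t := ht
    rw [(h.c n t (by linarith)).2.2.1.deriv]
    exact chi_deriv_pos σ n (by linarith)
  have hset : {t : ℝ | t ∈ Set.Ioc 0 x ∧ phiRobin σ n t = 0} = {t : ℝ | t ∈ Set.Ioc a x ∧ Real.sin (χ n t) = 0} := by
    ext t
    simp only [Set.mem_ofPred_eq, Set.mem_Ioc]
    constructor
    · rintro ⟨⟨h1, h2⟩, h3⟩
      refine ⟨⟨?_, h2⟩, (h.phi_iff n h1).1 h3⟩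
      by_contra hcon
      push Not at hcon
      exact (hφ t h1 hcon).ne' h3
    · rintro ⟨⟨h1, h2⟩, h3⟩
      have : 0 < t := by linarith
      exact ⟨⟨this, h2⟩, (h.phi_iff n this).2 h3⟩
  rw [hset]
  exact crossing hax hmono hcont (by linarith) hneg

lemma phi_pos_low {σ : ℝ} (hσ : 0 < σ) (n : ℕ) (hn : 1 ≤ n) {t : ℝ} (h0 : 0 < t) (h1 : t ≤ n) :
    0 < phiRobin σ n t := by
  rw [phi_eq]
  obtain ⟨a, b⟩ := bJK_pos n hn h0 h1
  positivity

lemma Ph.count {σ : ℝ} (hσ : 0 < σ) {η χ θ : ℕ → ℝ → ℝ} (h : Ph σ η χ θ) (n : ℕ) {x : ℝ} (hx : (n:ℝ) < x) :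
    ({t : ℝ | t ∈ Set.Ioc 0 x ∧ phiRobin σ n t = 0}).Finite ∧
    ∀ k : ℤ, 1 ≤ k → (k ≤ (({t : ℝ | t ∈ Set.Ioc 0 x ∧ phiRobin σ n t = 0}).ncard : ℤ) ↔
      (k - 1) * π ≤ χ n x) := by
  rcases Nat.eq_zero_or_pos n with h0 | h0
  · subst h0
    push_cast at hx
    have hc : Continuous (phiRobin σ 0) := by
      have : phiRobin σ 0 = fun x => bK 0 x + σ * besselJ 0 x := funext (phi_eq σ 0)
      rw [this]
      exact (bK_cont 0).add ((bj_cont 0).const_mul σ)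
    have hp : 0 < phiRobin σ 0 0 := by
      rw [phi_eq, bj_zero_zero, zero_add]
      exact mul_pos hσ (bj0_pos le_rfl (by norm_num))
    obtain ⟨ε, hε, hball⟩ := Metric.eventually_nhds_iff.1 (hc.continuousAt.eventually (lt_mem_nhds hp))
    have ha : 0 < min (ε/2) (min 1 x) := lt_min (by linarith) (lt_min one_pos hx)
    apply h.count_aux 0 ha (by push_cast; exact ha.le) ((min_le_right _ _).trans (min_le_right _ _))
    · intro t h1 h2
      apply bj_pos 0 h1
      refine h2.trans (max_le le_rfl ((min_le_right _ _).trans (min_le_left _ _)))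
    · intro t h1 h2
      apply hball
      rw [Real.dist_eq, sub_zero, abs_of_pos h1]
      have := h2.trans (min_le_left _ _)
      linarith
  · have hn : (1:ℝ) ≤ n := by exact_mod_cast h0
    apply h.count_aux n (a := n) (by linarith) le_rfl hx.le
    · intro t h1 h2
      rw [max_eq_right hn] at h2
      exact (bJK_pos n h0 h1 h2).1
    · intro t h1 h2
      exact phi_pos_low hσ n h0 h1 h2

lemma count_low {σ : ℝ} (hσ : 0 < σ) (n : ℕ) {x : ℝ} (h0 : 0 < x) (hx : x ≤ n) :
    ({t : ℝ | t ∈ Set.Ioc 0 x ∧ phiRobin σ n t = 0}) = ∅ := by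
  have hn : 1 ≤ n := by
    rcases Nat.eq_zero_or_pos n with h | h
    · subst h; push_cast at hx; linarith
    · exact h
  ext t
  simp only [Set.mem_ofPred_eq, Set.mem_Ioc, Set.mem_empty_iff_false, iff_false]
  rintro ⟨⟨h1, h2⟩, h3⟩
  exact (phi_pos_low hσ n hn h1 (h2.trans hx)).ne' h3

/-- number of zeros -/
noncomputable def NZ (σ : ℝ) (n : ℕ) (x : ℝ) : ℤ :=
  (({t : ℝ | t ∈ Set.Ioc 0 x ∧ phiRobin σ n t = 0}).ncard : ℤ)

lemma Ph.bulkA {σ : ℝ} (hσ : 0 < σ) {η χ θ : ℕ → ℝ → ℝ} (h : Ph σ η χ θ) {K : ℝ} (hK : 1 ≤ K) (n : ℕ) {x : ℝ}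
    (hx : (n:ℝ) < x) (hk : x^2 ≤ K^2 * (x^2 - n^2)) (k : ℤ) (hk1 : 1 ≤ k) :
    (k ≤ NZ σ n x → π * (k - 3/4) - (5 * K^6 + σ * K) / x ≤ TT n x) ∧
    (π * (k - 3/4) + (5 * K^6 + σ * K) / x ≤ TT n x → k ≤ NZ σ n x) := by
  have hn : (0:ℝ) ≤ n := Nat.cast_nonneg n
  have hx0 : 0 < x := by linarith
  have hK0 : 0 < K := by linarith
  have hp := pp_pos hx
  have hp2 := pp_sq hx
  have hxK : x ≤ K * pp n x := by
    apply le_of_sq_le_sq _ (by positivity)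
    rw [mul_pow, hp2]; exact hk
  have hcount := (h.count hσ n hx).2 k hk1
  change k ≤ NZ σ n x ↔ _ at hcount
  rw [hcount]
  have hm := h.main hK n hx hk
  have f1 := (h.t n).re hx
  have f2 := (h.t n).im hx
  have g1 := (h.c n).re hx0
  have g2 := (h.c n).im hx0
  have r1 := (h.t n).pos hx
  have r2 := (h.c n).pos hx0
  simp only [cQ, cS, cur_re, cur_im] at f1 f2 g1 g2
  have hd := h.tc n x hx
  set p := pp n x with hpdef
  set J := besselJ n x
  set B := bK n x
  set ε := (K^6 + σ * K) / x with hε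
  have hε0 : 0 ≤ ε := by positivity
  have bb1 : x^2 / (2 * p^3) ≤ K^6 / x := by
    rw [div_le_div_iff₀ (by positivity) hx0]
    have h3 : x^3 ≤ (K * p)^3 := by gcongr
    have h4 : K^3 ≤ K^6 := by gcongr; norm_num
    have h5 : K^3 * p^3 ≤ K^6 * p^3 := by gcongr
    have h6 : 0 ≤ K^6 * p^3 := by positivity
    nlinarith
  have bb2 : σ / p ≤ σ * K / x := by
    rw [div_le_div_iff₀ hp hx0]
    nlinarith
  have bb3 : 0 ≤ x^2 / (2 * p^3) := by positivity
  have bb4 : 0 ≤ σ / p := by positivity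
  have hεs : ε = K^6 / x + σ * K / x := by rw [hε]; ring
  have e0 : -(B / p + x^2 * J / (2 * p^3)) * J = (-(B + σ * J) * J) / p + (σ / p - x^2 / (2*p^3)) * J^2 := by
    field_simp; ring
  have ecoef1 : -ε ≤ σ / p - x^2 / (2*p^3) := by linarith [show 0 ≤ σ * K / x by positivity]
  have ecoef2 : σ / p - x^2 / (2*p^3) ≤ ε := by linarith [show 0 ≤ K^6 / x by positivity]
  have hsum : (5 * K^6 + σ * K) / x = 3 * K^6 / x + ε + K^6 / x := by rw [hε]; ring
  have hKx : 0 < K^6 / x := by positivity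
  rw [abs_le] at hm
  rw [hsum]
  constructor
  · intro hχ
    have := cell_iii r1 r2 f1 g1 f2 g2 hd hε0 (by
      intro h0
      rw [e0]
      have : 0 ≤ (-(B + σ * J) * J) / p := div_nonneg h0 hp.le
      have := mul_le_mul_of_nonneg_right ecoef1 (sq_nonneg J)
      linarith) (k-1) (by push_cast; exact hχ)
    push_cast at this
    linarith [hm.2]
  · intro hT
    by_contra hcon
    push Not at hcon
    -- mirror
    have := cell_iii (a := J) (θ := -θ n x) (χ := -χ n x) (ε := ε)
      (b1 := -(-(B / p + x^2 * J / (2 * p^3)))) (b2 := -(-(B + σ * J))) r1 r2 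
      (by rw [Real.cos_neg]; exact f1) (by rw [Real.cos_neg]; exact g1)
      (by rw [Real.sin_neg, mul_neg]; exact congrArg Neg.neg f2) (by rw [Real.sin_neg, mul_neg]; exact congrArg Neg.neg g2)
      (by rw [show -θ n x - -χ n x = -(θ n x - χ n x) by ring, abs_neg]; exact hd) hε0 (by
      intro h0
      rw [neg_mul (- (B / p + x^2 * J / (2 * p^3))), e0]
      have : 0 ≤ (- -(B + σ * J) * J) / p := div_nonneg h0 hp.le
      have e : (- -(B + σ * J) * J) / p = -((-(B + σ * J) * J) / p) := by ring
      have := mul_le_mul_of_nonneg_right ecoef2 (sq_nonneg J)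
      linarith) (-(k-1)) (by push_cast; linarith)
    push_cast at this
    linarith [hm.1]


lemma TT_inc {m : ℕ} {K x y : ℝ} (hK : 1 ≤ K) (hx : (m:ℝ) < x) (hk : x^2 ≤ K^2 * (x^2 - m^2)) (hxy : x ≤ y) :
    TT m x + (y - x) / K ≤ TT m y := by
  have hn : (0:ℝ) ≤ m := Nat.cast_nonneg m
  have hx0 : 0 < x := by linarith
  have hK0 : 0 < K := by linarith
  have hd : ∀ t, x ≤ t → HasDerivAt (fun t => TT m t - t / K) (pp m t / t - 1 / K) t := fun t ht =>
    (TT_d (by linarith)).sub ((hasDerivAt_id t).div_const K)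
  have hm : MonotoneOn (fun t => TT m t - t / K) (Set.Ici x) := by
    apply monotoneOn_of_deriv_nonneg (convex_Ici x)
    · intro t ht; exact (hd t ht).continuousAt.continuousWithinAt
    · intro t ht; rw [interior_Ici] at ht
      exact (hd t (le_of_lt ht)).differentiableAt.differentiableWithinAt
    · intro t ht; rw [interior_Ici] at ht
      have ht : x < t := ht
      rw [(hd t ht.le).deriv]
      have htm : (m:ℝ) < t := by linarith
      have ht0 : 0 < t := by linarith
      have hp := pp_pos htm
      have hp2 := pp_sq htm
      have hkt1 : t ≤ K * pp m t := by
        apply le_of_sq_le_sq _ (by positivity)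
        rw [mul_pow, hp2]
        have : x^2 ≤ t^2 := by nlinarith
        have hK2 : 0 ≤ K^2 - 1 := by nlinarith
        nlinarith
      rw [sub_nonneg, div_le_div_iff₀ hK0 ht0]; linarith
  have := hm (Set.mem_Ici.2 le_rfl) (Set.mem_Ici.2 hxy) hxy
  simp only at this
  rw [sub_div]; linarith

lemma TT_le_pp (m : ℕ) (x : ℝ) : TT m x ≤ pp m x := by
  unfold TT
  have := mul_nonneg (Nat.cast_nonneg (α := ℝ) m) (Real.arccos_nonneg ((m:ℝ)/x))
  linarith

lemma g_TT (m : ℕ) {μ : ℝ} (hμ : 0 < μ) : π * (μ * gfun (m / μ)) = TT m μ := by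
  unfold gfun TT pp
  have h1 : Real.sqrt (μ^2 - (m:ℝ)^2) = μ * Real.sqrt (1 - ((m:ℝ)/μ)^2) := by
    have : μ^2 - (m:ℝ)^2 = μ^2 * (1 - ((m:ℝ)/μ)^2) := by field_simp
    rw [this, Real.sqrt_mul (by positivity), Real.sqrt_sq hμ.le]
  rw [h1]
  have := Real.pi_pos
  field_simp

lemma g_neg (x : ℝ) : gfun (-x) = gfun x + x := by
  unfold gfun
  rw [Real.arccos_neg]
  have := Real.pi_pos
  field_simp
  ring_nf

lemma natAbs_real (n : ℤ) : ((n.natAbs : ℕ) : ℝ) = |(n:ℝ)| := by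
  rw [Nat.cast_natAbs, Int.cast_abs]

lemma mem_iff {μ : ℝ} (hμ : 0 < μ) (n k : ℤ) (hk : 1 ≤ k) :
    (((n:ℝ), (k:ℝ) + max 0 (-(n:ℝ)) - 3/4) ∈ μ • domD) ↔
      ((n.natAbs : ℝ) ≤ μ ∧ π * (k - 3/4) ≤ TT n.natAbs μ) := by
  have hπ := Real.pi_pos
  have hk' : (1:ℝ) ≤ k := by exact_mod_cast hk
  rw [Set.mem_smul_set_iff_inv_smul_mem₀ hμ.ne']
  simp only [domD, Set.mem_ofPred_eq, Prod.smul_mk, smul_eq_mul]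
  rw [← g_TT _ hμ, mul_le_mul_iff_right₀ hπ, natAbs_real]
  have e : ∀ z : ℝ, μ⁻¹ * z = z / μ := fun z => by rw [div_eq_inv_mul]
  simp only [e]
  rcases le_total 0 n with h | h
  · have hn : (0:ℝ) ≤ n := by exact_mod_cast h
    have hq : 0 ≤ (n:ℝ) / μ := by positivity
    have m1 : max 0 (-(n:ℝ)) = 0 := max_eq_left (by linarith)
    have m2 : max 0 (-((n:ℝ) / μ)) = 0 := max_eq_left (by linarith)
    rw [abs_of_nonneg hn, m1, m2, div_le_one hμ, add_zero, div_le_iff₀ hμ (a := gfun ((n:ℝ)/μ)), mul_comm μ]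
    constructor
    · rintro ⟨_, h2, _, h4⟩; exact ⟨h2, by linarith⟩
    · rintro ⟨h2, h4⟩
      refine ⟨?_, h2, ?_, by linarith⟩
      · have : 0 ≤ (n:ℝ) / μ := by positivity
        linarith
      · apply div_nonneg _ hμ.le; linarith
  · have hn : (n:ℝ) ≤ 0 := by exact_mod_cast h
    have hn' : (n:ℝ) / μ ≤ 0 := div_nonpos_of_nonpos_of_nonneg hn hμ.le
    rw [abs_of_nonpos hn, max_eq_right (by linarith), max_eq_right (by linarith)]
    have e2 : gfun ((n:ℝ) / μ) = gfun (-(n:ℝ) / μ) + -(n:ℝ) / μ := by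
      rw [← g_neg]; congr 1; ring
    rw [e2]
    have e3 : ((k:ℝ) + -(n:ℝ) - 3/4) / μ = (k - 3/4) / μ + -(n:ℝ) / μ := by ring
    rw [e3, add_le_add_iff_right, div_le_iff₀ hμ (a := gfun (-(n:ℝ)/μ)), mul_comm μ]
    constructor
    · rintro ⟨h1, h2, _, h4⟩
      rw [le_div_iff₀ hμ] at h1
      exact ⟨by linarith, h4⟩
    · rintro ⟨h2, h4⟩
      refine ⟨?_, by linarith, ?_, h4⟩
      · rw [le_div_iff₀ hμ]; linarith
      · rw [neg_div]
        have : 0 ≤ ((k:ℝ) - 3/4) / μ := div_nonneg (by linarith) hμ.le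
        linarith

lemma pp_le {m : ℕ} {x : ℝ} (hx : 0 < x) : pp m x ≤ x := by
  unfold pp
  rw [Real.sqrt_le_left hx.le]
  have := sq_nonneg (m:ℝ)
  linarith

lemma lat_finite (c : ℝ) {μ : ℝ} (hμ : 0 < μ) :
    ({p : ℤ × ℤ | 1 ≤ p.2 ∧ |(p.1 : ℝ)| < c * (p.2 : ℝ) ∧
    ((p.1 : ℝ), (p.2 : ℝ) + max 0 (-(p.1 : ℝ)) - 3/4) ∈ μ • domD}).Finite := by
  apply Set.Finite.subset ((Set.finite_Icc (-⌈μ⌉) ⌈μ⌉).prod (Set.finite_Icc 1 (⌈μ⌉+1)))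
  rintro ⟨n, k⟩ ⟨h1, h2, h3⟩
  simp only at h1 h2 h3
  rw [mem_iff hμ n k h1, natAbs_real] at h3
  obtain ⟨h4, h5⟩ := h3
  have hc := Int.le_ceil μ
  have h6 := h5.trans ((TT_le_pp _ _).trans (pp_le hμ))
  have hk : (1:ℝ) ≤ k := by exact_mod_cast h1
  have hπ := Real.pi_gt_three
  rw [abs_le] at h4
  simp only [Set.mem_prod, Set.mem_Icc]
  refine ⟨⟨?_, ?_⟩, h1, ?_⟩
  · have : (((-⌈μ⌉ : ℤ)) : ℝ) ≤ (n:ℝ) := by push_cast; linarith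
    exact_mod_cast this
  · have : (n:ℝ) ≤ (⌈μ⌉ : ℝ) := by linarith
    exact_mod_cast this
  · have : (k:ℝ) ≤ ((⌈μ⌉ + 1 : ℤ) : ℝ) := by push_cast; nlinarith
    exact_mod_cast this

set_option maxHeartbeats 1000000 in
theorem disk_bulk_range_comparison (σ c : ℝ) (hσ : 0 < σ) (hc : 0 < c) :
    ∃ C : ℝ, 0 < C ∧ ∃ μ₀ : ℝ, 0 < μ₀ ∧ ∀ μ : ℝ, μ₀ ≤ μ →
      latticeCountD1 c (μ - C / μ) ≤ diskRobinCount1 σ c μ ∧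
      diskRobinCount1 σ c μ ≤ latticeCountD1 c (μ + C / μ) := by
  obtain ⟨η, χ, θ, h⟩ := Ph_exists σ
  have hπ := Real.pi_gt_three
  set K := Real.sqrt (32 * c^2 + 2) with hKdef
  have hK2 : K^2 = 32 * c^2 + 2 := Real.sq_sqrt (by positivity)
  have hK : 1 ≤ K := by
    rw [hKdef, Real.one_le_sqrt]; nlinarith
  have hK0 : 0 < K := by linarith
  set C0 := 5 * K^6 + σ * K with hC0def
  have hC0 : 0 < C0 := by positivity
  set C := C0 * K with hCdef
  have hC : 0 < C := by positivity
  have hCK : ∀ μ : ℝ, 0 < μ → (C / μ) / K = C0 / μ := by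
    intro μ hμ; rw [hCdef]; field_simp
  refine ⟨C, hC, 3 * C0 + C + 1, by positivity, fun μ hμ0 => ?_⟩
  have hμ1 : 1 ≤ μ := by linarith
  have hμ : 0 < μ := by linarith
  have hCμ : 0 < C / μ := by positivity
  have hCμ1 : C / μ < 1 := by rw [div_lt_one hμ]; linarith
  have hC0μ : C0 / μ ≤ 1/3 := by rw [div_le_iff₀ hμ]; linarith
  have hν : 0 < μ - C / μ := by linarith
  have hν' : 0 < μ + C / μ := by linarith
  -- upper inclusion
  have hup : {p : ℤ × ℤ | 1 ≤ p.2 ∧ |(p.1 : ℝ)| < c * (p.2 : ℝ) ∧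
      p.2 ≤ (({t : ℝ | t ∈ Set.Ioc 0 μ ∧ phiRobin σ p.1.natAbs t = 0}).ncard : ℤ)} ⊆
      {p : ℤ × ℤ | 1 ≤ p.2 ∧ |(p.1 : ℝ)| < c * (p.2 : ℝ) ∧
      ((p.1 : ℝ), (p.2 : ℝ) + max 0 (-(p.1 : ℝ)) - 3/4) ∈ (μ + C / μ) • domD} := by
    rintro ⟨n, k⟩ ⟨h1, h2, h3⟩
    simp only at h1 h2 h3
    refine ⟨h1, h2, ?_⟩
    simp only
    rw [mem_iff hν' n k h1]
    rw [← natAbs_real] at h2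
    set m := n.natAbs
    have hm0 : (0:ℝ) ≤ m := Nat.cast_nonneg m
    have hk : (1:ℝ) ≤ k := by exact_mod_cast h1
    have hmμ : (m:ℝ) < μ := by
      by_contra hcon
      push Not at hcon
      rw [count_low hσ m hμ hcon] at h3
      simp at h3
      omega
    -- enlarge
    set l := Real.sqrt (1 + 1 / (32 * c^2)) with hl
    have hl2 : l^2 = 1 + 1 / (32 * c^2) := Real.sq_sqrt (by positivity)
    have hl1 : 1 ≤ l := by
      rw [hl, Real.one_le_sqrt]
      have : 0 < 1 / (32 * c^2) := by positivity
      linarith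
    have hμl : μ ≤ l * μ := by nlinarith
    have hml : (m:ℝ) < l * μ := by linarith
    have hm2 : (m:ℝ)^2 ≤ μ^2 := by nlinarith
    have hlm : 32 * c^2 * l^2 = 32 * c^2 + 1 := by rw [hl2]; field_simp
    have hkl : (l * μ)^2 ≤ K^2 * ((l*μ)^2 - m^2) := by
      rw [hK2, mul_pow]
      have hll : 1 ≤ l^2 := by nlinarith
      linear_combination (32 * c^2 + 2) * hm2 - μ^2 * hlm + μ^2 * hll
    have hNZ : k ≤ NZ σ m (l * μ) := by
      refine h3.trans ?_
      unfold NZ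
      have := Set.ncard_le_ncard (s := {t : ℝ | t ∈ Set.Ioc 0 μ ∧ phiRobin σ m t = 0})
        (t := {t : ℝ | t ∈ Set.Ioc 0 (l*μ) ∧ phiRobin σ m t = 0})
        (fun t ht => ⟨⟨ht.1.1, ht.1.2.trans hμl⟩, ht.2⟩) (h.count hσ m hml).1
      exact_mod_cast this
    have hA := (h.bulkA hσ hK m hml hkl k h1).1 hNZ
    have hC0l : C0 / (l * μ) ≤ 1/3 := by
      refine le_trans ?_ hC0μ
      gcongr
    have hpA := hA.trans (TT_le_pp _ _)
    have hp := pp_pos hml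
    have hp2 := pp_sq hml
    have hmp : (m:ℝ) ≤ 4 * c * pp m (l * μ) := by
      have : (k:ℝ) ≤ 4 * pp m (l*μ) := by nlinarith
      nlinarith
    have hmp2 : (m:ℝ)^2 ≤ 16 * c^2 * ((l*μ)^2 - m^2) := by
      rw [← hp2]
      have := pow_le_pow_left₀ hm0 hmp 2
      linear_combination this
    have hkμ : μ^2 ≤ K^2 * (μ^2 - m^2) := by
      rw [hK2]
      rw [mul_pow] at hmp2
      linear_combination 2 * hmp2 + μ^2 * hlm
    have hA2 := (h.bulkA hσ hK m hmμ hkμ k h1).1 h3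
    have hT := TT_inc hK hmμ hkμ (show μ ≤ μ + C / μ by linarith)
    rw [add_sub_cancel_left, hCK μ hμ] at hT
    exact ⟨by linarith, by linarith⟩
  have hlow : {p : ℤ × ℤ | 1 ≤ p.2 ∧ |(p.1 : ℝ)| < c * (p.2 : ℝ) ∧
      ((p.1 : ℝ), (p.2 : ℝ) + max 0 (-(p.1 : ℝ)) - 3/4) ∈ (μ - C / μ) • domD} ⊆ 
      {p : ℤ × ℤ | 1 ≤ p.2 ∧ |(p.1 : ℝ)| < c * (p.2 : ℝ) ∧
      p.2 ≤ (({t : ℝ | t ∈ Set.Ioc 0 μ ∧ phiRobin σ p.1.natAbs t = 0}).ncard : ℤ)} := by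
    rintro ⟨n, k⟩ ⟨h1, h2, h3⟩
    simp only at h1 h2 h3
    refine ⟨h1, h2, ?_⟩
    simp only
    rw [mem_iff hν n k h1] at h3
    rw [← natAbs_real] at h2
    set m := n.natAbs
    set ν := μ - C / μ with hνdef
    obtain ⟨h4, h5⟩ := h3
    have hm0 : (0:ℝ) ≤ m := Nat.cast_nonneg m
    have hk : (1:ℝ) ≤ k := by exact_mod_cast h1
    have hpA := h5.trans (TT_le_pp _ _)
    have hmν : (m:ℝ) < ν := by
      rcases lt_or_eq_of_le h4 with h | h
      · exact h
      · exfalso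
        unfold pp at hpA
        rw [h, sub_self, Real.sqrt_zero] at hpA
        nlinarith
    have hp := pp_pos hmν
    have hp2 := pp_sq hmν
    have hmp : (m:ℝ) ≤ 4 * c * pp m ν := by
      have : (k:ℝ) ≤ 4 * pp m ν := by nlinarith
      nlinarith
    have hmp2 : (m:ℝ)^2 ≤ 16 * c^2 * (ν^2 - m^2) := by
      rw [← hp2]
      have := pow_le_pow_left₀ hm0 hmp 2
      linear_combination this
    have hd : 0 < ν^2 - (m:ℝ)^2 := by rw [← hp2]; positivity
    have hkν : ν^2 ≤ K^2 * (ν^2 - m^2) := by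
      rw [hK2]
      nlinarith [mul_pos (show 0 < c^2 by positivity) hd]
    have hmμ : (m:ℝ) < μ := by linarith
    have hkμ : μ^2 ≤ K^2 * (μ^2 - m^2) := by
      have : ν^2 ≤ μ^2 := by nlinarith
      have hK2 : 0 ≤ K^2 - 1 := by nlinarith
      nlinarith
    have hT := TT_inc hK hmν hkν (show ν ≤ μ by linarith)
    rw [show μ - ν = C / μ by rw [hνdef]; ring, hCK μ hμ] at hT
    exact (h.bulkA hσ hK m hmμ hkμ k h1).2 (by linarith)
  constructor
  · exact Set.ncard_le_ncard hlow ((lat_finite c hν').subset hup)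
  · exact Set.ncard_le_ncard hup (lat_finite c hν')
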